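/- arXiv:2406.17867 — 2 statements merged into one kernel-verified Lean document; each statement's English description precedes it below -/
import Mathlib

section
/- The repetition threshold for infinite Rote sequences is 5/2: every infinite binary sequence with factor complexity 2n has critical exponent at least 5/2, and there exists an infinite binary sequence with factor complexity 2n whose critical exponent equals 5/2. -/
/-- The finite block of length `n` occurring at position `i` in the infinite word `x`. -/
def FactorAt {A : Type*} (x : ℕ → A) (i n : ℕ) : List A :=
  (List.range n).map fun t => x (i + t)

/-- `w` is a (finite) factor of the infinite word `x`. -/
def IsFactor {A : Type*} (x : ℕ → A) (w : List A) : Prop :=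
  ∃ i, w = FactorAt x i w.length

/-- Factor complexity of an infinite word: the number of distinct factors of length `n`. -/
noncomputable def complexity {A : Type*} (x : ℕ → A) (n : ℕ) : ℕ :=
  Set.ncard {w : List A | w.length = n ∧ IsFactor x w}

/-- Factor complexity of a finite word: the number of distinct factors of length `n`. -/
noncomputable def complexityF {A : Type*} (z : List A) (n : ℕ) : ℕ :=
  Set.ncard {w : List A | w.length = n ∧ w <:+: z}

/-- `p` is a period of the finite word `y`:  `1 ≤ p ≤ |y|` and `y[j] = y[j+p]`
for all `0 ≤ j < |y| - p`. -/
def HasPeriod {A : Type*} [Inhabited A] (y : List A) (p : ℕ) : Prop :=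
  1 ≤ p ∧ p ≤ y.length ∧ ∀ j, j + p < y.length → y.getD j default = y.getD (j + p) default

/-- The smallest period of a finite word. -/
noncomputable def minPeriod {A : Type*} [Inhabited A] (y : List A) : ℕ :=
  sInf {p | HasPeriod y p}

/-- The exponent of a finite word: its length divided by its smallest period. -/
noncomputable def exponent {A : Type*} [Inhabited A] (y : List A) : ℚ :=
  (y.length : ℚ) / (minPeriod y : ℚ)

/-- The critical exponent of an infinite word: the supremum of the exponents of its
nonempty finite factors. -/
noncomputable def criticalExponent {A : Type*} [Inhabited A] (x : ℕ → A) : ENNReal :=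
  sSup {e : ENNReal | ∃ w, IsFactor x w ∧ w ≠ [] ∧ e = ENNReal.ofReal ((exponent w : ℚ) : ℝ)}

/-- The image of a finite word under a morphism given by its action on letters. -/
def mapWord {k : ℕ} {A : Type*} (σ : Fin k → List A) (w : List (Fin k)) : List A :=
  (w.map σ).flatten

/-- The image of an infinite word under a (nonerasing) morphism given by its action on
letters: the `n`-th letter of the concatenation `σ (x 0) ++ σ (x 1) ++ ⋯`. -/
def applyMorph {k : ℕ} {A : Type*} [Inhabited A] (σ : Fin k → List A) (x : ℕ → Fin k) :
    ℕ → A :=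
  fun n => (((List.range (n + 1)).map fun i => σ (x i)).flatten).getD n default

/-- The morphism `h` with `h(0) = 01`, `h(1) = 21`, `h(2) = 0`. -/
def hm : Fin 3 → List (Fin 3) := ![[0, 1], [2, 1], [0]]

/-- The morphism `g` with `g(0) = 011`, `g(1) = 0`, `g(2) = 01`. -/
def gm : Fin 3 → List (Fin 2) := ![[0, 1, 1], [0], [0, 1]]

/-- The abelian complexity of a binary infinite word at `n`: the number of distinct
values taken by the count of `0`'s among its length-`n` factors. -/
noncomputable def abelianComplexity (x : ℕ → Fin 2) (n : ℕ) : ℕ :=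
  Set.ncard {z : ℕ | ∃ i, z = (FactorAt x i n).count 0}

/-! ### The lower bound: a finite search -/

/-- The block of `x` of length `n` at position `i`, read as a binary numeral. -/
def blockCode (x : ℕ → Fin 2) (i : ℕ) : ℕ → ℕ
  | 0 => 0
  | n + 1 => 2 * blockCode x i n + (x (i + n)).val

/-- Does the binary word of length `n` coded by `c` have a suffix of exponent at least `5/2`
with period in `1, …, P`? -/
def hasPowerSuffix (c n : ℕ) : ℕ → Bool
  | 0 => false
  | p + 1 =>
    bif Nat.ble (p + 1 + (3 * p + 4) / 2) n then
      bif Nat.beq (c % 2 ^ ((3 * p + 4) / 2)) (c / 2 ^ (p + 1) % 2 ^ ((3 * p + 4) / 2)) then true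
      else hasPowerSuffix c n p
    else hasPowerSuffix c n p

/-- Insert `a` into a list unless it is already there. -/
def insertNew (a : ℕ) (l : List ℕ) : List ℕ :=
  bif l.any (Nat.beq a) then l else a :: l

/-- Evaluate a natural number before passing it on. -/
def forceNat (f : ℕ → Bool) : ℕ → Bool
  | 0 => f 0
  | n + 1 => f (n + 1)

/-- Does every binary word extending the word of length `n` coded by `c` by `fuel` letters
contain a power of exponent at least `5/2`, or more than eight blocks of length four?
The list `seen` records blocks of length four which occur in the word. -/
def searchFails : ℕ → ℕ → ℕ → List ℕ → Bool
  | 0, _, _, _ => false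
  | fuel + 1, n, c, seen =>
    [2 * c, 2 * c + 1].all fun c' => forceNat (fun d =>
      hasPowerSuffix d (n + 1) 14 ||
        (bif Nat.ble 4 (n + 1) then
          forceNat (fun b =>
            bif Nat.ble 9 (insertNew b seen).length then true
            else searchFails fuel (n + 1) d (insertNew b seen)) (d % 16)
        else searchFails fuel (n + 1) d seen)) c'

set_option maxRecDepth 100000 in
theorem searchFails_root : searchFails 39 0 0 [] = true := by decide +kernel


theorem forceNat_eq (f : ℕ → Bool) (n : ℕ) : forceNat f n = f n := by
  cases n <;> rfl

/-- The blocks of length `n` at positions `i` and `j` of `x` coincide. -/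
def Agree {A : Type*} (x : ℕ → A) (i j n : ℕ) : Prop :=
  ∀ t < n, x (i + t) = x (j + t)

theorem blockCode_lt (x : ℕ → Fin 2) (i n : ℕ) : blockCode x i n < 2 ^ n := by
  induction n with
  | zero => simp [blockCode]
  | succ n ih =>
    have := (x (i + n)).isLt
    rw [blockCode, pow_succ]
    omega

theorem blockCode_add (x : ℕ → Fin 2) (i m k : ℕ) :
    blockCode x i (m + k) = 2 ^ k * blockCode x i m + blockCode x (i + m) k := by
  induction k with
  | zero => simp [blockCode]
  | succ k ih =>
    rw [← add_assoc, blockCode, ih, blockCode, pow_succ, add_assoc i m k]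
    ring

theorem blockCode_add_mod (x : ℕ → Fin 2) (i m k : ℕ) :
    blockCode x i (m + k) % 2 ^ k = blockCode x (i + m) k := by
  rw [blockCode_add, Nat.mul_add_mod, Nat.mod_eq_of_lt (blockCode_lt x _ k)]

theorem blockCode_add_div (x : ℕ → Fin 2) (i m k : ℕ) :
    blockCode x i (m + k) / 2 ^ k = blockCode x i m := by
  rw [blockCode_add, Nat.mul_add_div (by positivity), Nat.div_eq_of_lt (blockCode_lt x _ k),
    add_zero]

theorem agree_of_blockCode_eq {x : ℕ → Fin 2} {i j n : ℕ}
    (h : blockCode x i n = blockCode x j n) : Agree x i j n := by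
  induction n with
  | zero => intro t ht; omega
  | succ n ih =>
    have h1 := (x (i + n)).isLt
    have h2 := (x (j + n)).isLt
    simp only [blockCode] at h
    intro t ht
    rcases Nat.lt_succ_iff_lt_or_eq.mp ht with ht | rfl
    · exact ih (by omega) t ht
    · exact Fin.ext (by omega)

theorem blockCode_eq_of_agree {x : ℕ → Fin 2} {i j n : ℕ}
    (h : Agree x i j n) : blockCode x i n = blockCode x j n := by
  induction n with
  | zero => rfl
  | succ n ih =>
    rw [blockCode, blockCode, ih fun t ht => h t (by omega), h n (by omega)]

theorem hasPowerSuffix_sound {x : ℕ → Fin 2} {n P : ℕ}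
    (h : hasPowerSuffix (blockCode x 0 n) n P = true) :
    ∃ s p q, 1 ≤ p ∧ 3 * p ≤ 2 * q ∧ Agree x s (s + p) q := by
  induction P with
  | zero => simp [hasPowerSuffix] at h
  | succ p ih =>
    rw [hasPowerSuffix] at h
    cases h1 : Nat.ble (p + 1 + (3 * p + 4) / 2) n with
    | false => rw [h1] at h; exact ih h
    | true =>
      rw [h1, cond_true] at h
      generalize hq : (3 * p + 4) / 2 = q at h h1
      obtain ⟨s, rfl⟩ := Nat.exists_eq_add_of_le (Nat.le_of_ble_eq_true h1)
      cases h2 : Nat.beq (blockCode x 0 (p + 1 + q + s) % 2 ^ q)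
          (blockCode x 0 (p + 1 + q + s) / 2 ^ (p + 1) % 2 ^ q) with
      | false => rw [h2] at h; exact ih h
      | true =>
        refine ⟨s, p + 1, q, by omega, by omega, ?_⟩
        have h3 := Nat.eq_of_beq_eq_true h2
        rw [show p + 1 + q + s = s + (p + 1) + q by ring, blockCode_add_mod,
          show s + (p + 1) + q = (s + q) + (p + 1) by ring, blockCode_add_div,
          blockCode_add_mod, zero_add, zero_add] at h3
        exact (agree_of_blockCode_eq h3.symm)

theorem factorAt_eq_iff {A : Type*} {x : ℕ → A} {i j n : ℕ} :
    FactorAt x i n = FactorAt x j n ↔ Agree x i j n := by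
  simp [FactorAt, Agree, List.map_inj_left]

@[simp] theorem length_factorAt {A : Type*} (x : ℕ → A) (i n : ℕ) :
    (FactorAt x i n).length = n := by
  simp [FactorAt]

/-- The factors of length `n` of the infinite word `x`. -/
def factorSet {A : Type*} (x : ℕ → A) (n : ℕ) : Set (List A) :=
  {w | w.length = n ∧ IsFactor x w}

theorem factorSet_eq_range {A : Type*} (x : ℕ → A) (n : ℕ) :
    factorSet x n = Set.range fun i => FactorAt x i n := by
  ext w
  constructor
  · rintro ⟨rfl, i, hi⟩
    exact ⟨i, hi.symm⟩
  · rintro ⟨i, rfl⟩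
    exact ⟨length_factorAt x i n, i, by simp⟩

theorem factorSet_finite {A : Type*} [Finite A] (x : ℕ → A) (n : ℕ) : (factorSet x n).Finite :=
  (List.finite_length_eq A n).subset fun _ h => h.1

theorem length_le_complexity {x : ℕ → Fin 2} {k : ℕ} {l : List ℕ} (hl : l.Nodup)
    (h : ∀ a ∈ l, ∃ i, a = blockCode x i k) : l.length ≤ complexity x k := by
  choose! f hf using h
  have hinj : Set.InjOn (fun a => FactorAt x (f a) k) (l.toFinset : Set ℕ) := by
    intro a ha b hb hab
    simp only [List.coe_toFinset, Set.mem_ofPred_eq] at ha hb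
    rw [hf a ha, hf b hb, blockCode_eq_of_agree (factorAt_eq_iff.mp hab)]
  rw [← List.toFinset_card_of_nodup hl, ← Set.ncard_coe_finset, ← hinj.ncard_image]
  refine Set.ncard_le_ncard ?_ (factorSet_finite x k)
  rintro _ ⟨a, -, rfl⟩
  exact ⟨length_factorAt x (f a) k, f a, by simp⟩

theorem searchFails_sound {x : ℕ → Fin 2} (hx : complexity x 4 ≤ 8) (fuel n : ℕ) (seen : List ℕ)
    (hn : seen.Nodup) (hs : ∀ a ∈ seen, ∃ i, a = blockCode x i 4)
    (h : searchFails fuel n (blockCode x 0 n) seen = true) :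
    ∃ s p q, 1 ≤ p ∧ 3 * p ≤ 2 * q ∧ Agree x s (s + p) q := by
  induction fuel generalizing n seen with
  | zero => simp [searchFails] at h
  | succ fuel ih =>
    rw [searchFails, List.all_eq_true] at h
    have hmem : blockCode x 0 (n + 1) ∈
        [2 * blockCode x 0 n, 2 * blockCode x 0 n + 1] := by
      have := (x (0 + n)).isLt
      simp only [blockCode, List.mem_cons, List.not_mem_nil, or_false]
      omega
    have h1 := h _ hmem
    rw [forceNat_eq, Bool.or_eq_true] at h1
    rcases h1 with h1 | h1
    · exact hasPowerSuffix_sound h1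
    cases h4 : Nat.ble 4 (n + 1) with
    | false =>
      rw [h4, cond_false] at h1
      exact ih _ _ hn hs h1
    | true =>
      rw [h4, cond_true, forceNat_eq] at h1
      obtain ⟨m, hm⟩ := Nat.exists_eq_add_of_le' (Nat.le_of_ble_eq_true h4)
      have hb : blockCode x 0 (n + 1) % 16 = blockCode x m 4 := by
        rw [hm]
        simpa using blockCode_add_mod x 0 m 4
      rw [hb] at h1
      have hn' : (insertNew (blockCode x m 4) seen).Nodup := by
        rw [insertNew]
        cases ha : seen.any (Nat.beq (blockCode x m 4)) with
        | true => exact hn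
        | false =>
          refine List.nodup_cons.mpr ⟨fun hc => ?_, hn⟩
          have := List.any_eq_false.mp ha _ hc
          simp at this
      have hs' : ∀ a ∈ insertNew (blockCode x m 4) seen, ∃ i, a = blockCode x i 4 := by
        intro a
        rw [insertNew]
        cases seen.any (Nat.beq (blockCode x m 4)) with
        | true => exact hs a
        | false =>
          intro ha
          rcases List.mem_cons.mp ha with rfl | ha
          · exact ⟨m, rfl⟩
          · exact hs a ha
      have hlen := length_le_complexity hn' hs'
      have h9 : Nat.ble 9 (insertNew (blockCode x m 4) seen).length = false := by
        rw [← Bool.not_eq_true, Nat.ble_eq]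
        omega
      rw [h9, cond_false] at h1
      exact ih _ _ hn' hs' h1

theorem exists_repetition {x : ℕ → Fin 2} (hx : complexity x 4 ≤ 8) :
    ∃ s p q, 1 ≤ p ∧ 3 * p ≤ 2 * q ∧ Agree x s (s + p) q :=
  searchFails_sound hx 39 0 [] List.nodup_nil (by simp) searchFails_root

theorem getD_factorAt {A : Type*} [Inhabited A] {x : ℕ → A} {i n t : ℕ} (h : t < n) :
    (FactorAt x i n).getD t default = x (i + t) := by
  simp [FactorAt, List.getD_eq_getElem?_getD, h]

theorem hasPeriod_factorAt {A : Type*} [Inhabited A] {x : ℕ → A} {i n p : ℕ} :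
    HasPeriod (FactorAt x i n) p ↔ 1 ≤ p ∧ p ≤ n ∧ Agree x i (i + p) (n - p) := by
  rw [HasPeriod, length_factorAt]
  refine and_congr_right fun _ => and_congr_right fun hp => forall_congr' fun t => ?_
  rw [lt_tsub_iff_right]
  refine forall_congr' fun ht => ?_
  rw [getD_factorAt (by omega), getD_factorAt ht, add_assoc i p t, add_comm p t]

theorem ennreal_five_halves : (5 : ENNReal) / 2 = ENNReal.ofReal (5 / 2) := by
  rw [ENNReal.ofReal_div_of_pos (by norm_num)]
  norm_num

theorem five_halves_le_criticalExponent {x : ℕ → Fin 2} (hx : complexity x 4 ≤ 8) :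
    (5 : ENNReal) / 2 ≤ criticalExponent x := by
  obtain ⟨s, p, q, hp, hpq, h⟩ := exists_repetition hx
  have hper : HasPeriod (FactorAt x s (p + q)) p := by
    rw [hasPeriod_factorAt, Nat.add_sub_cancel_left]
    exact ⟨hp, by omega, h⟩
  have hmin : HasPeriod (FactorAt x s (p + q)) (minPeriod (FactorAt x s (p + q))) :=
    Nat.sInf_mem (s := {p | HasPeriod _ p}) ⟨p, hper⟩
  have hle : minPeriod (FactorAt x s (p + q)) ≤ p := Nat.sInf_le hper
  refine le_sSup_of_le ⟨FactorAt x s (p + q), ⟨s, by simp⟩, ?_, rfl⟩ ?_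
  · rw [← List.length_pos_iff_ne_nil, length_factorAt]
    omega
  · rw [ennreal_five_halves]
    refine ENNReal.ofReal_le_ofReal ?_
    have hq : (5 / 2 : ℚ) ≤ exponent (FactorAt x s (p + q)) := by
      have hpos : (0 : ℚ) < minPeriod (FactorAt x s (p + q)) := by
        exact_mod_cast hmin.1
      rw [exponent, length_factorAt, div_le_div_iff₀ (by norm_num) hpos]
      have h1 : (minPeriod (FactorAt x s (p + q)) : ℚ) ≤ p := by exact_mod_cast hle
      have h2 : (3 * p : ℚ) ≤ 2 * q := by exact_mod_cast hpq
      push_cast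
      linarith
    calc (5 / 2 : ℝ) = ((5 / 2 : ℚ) : ℝ) := by norm_num
      _ ≤ _ := by exact_mod_cast hq

theorem criticalExponent_le_five_halves {x : ℕ → Fin 2}
    (hx : ∀ i p n, 1 ≤ p → Agree x i (i + p) n → 2 * n ≤ 3 * p) :
    criticalExponent x ≤ 5 / 2 := by
  refine sSup_le ?_
  rintro _ ⟨w, ⟨i, hi⟩, hw, rfl⟩
  generalize hn : w.length = n at hi
  subst hi
  have hpos : 0 < n := by
    rw [← hn]
    exact List.length_pos_iff_ne_nil.mpr hw
  have hmin : HasPeriod (FactorAt x i n) (minPeriod (FactorAt x i n)) := by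
    refine Nat.sInf_mem (s := {p | HasPeriod _ p}) ⟨n, hasPeriod_factorAt.mpr ⟨hpos, le_rfl, ?_⟩⟩
    intro t ht
    omega
  generalize hp : minPeriod (FactorAt x i n) = p at hmin
  rw [hasPeriod_factorAt] at hmin
  have hbound := hx i p (n - p) hmin.1 hmin.2.2
  rw [ennreal_five_halves]
  refine ENNReal.ofReal_le_ofReal ?_
  have hq : exponent (FactorAt x i n) ≤ (5 / 2 : ℚ) := by
    have hp0 : (0 : ℚ) < p := by exact_mod_cast hmin.1
    rw [exponent, length_factorAt, hp, div_le_div_iff₀ hp0 (by norm_num)]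
    have : n * 2 ≤ 5 * p := by omega
    exact_mod_cast this
  calc ((exponent (FactorAt x i n) : ℚ) : ℝ) ≤ ((5 / 2 : ℚ) : ℝ) := by exact_mod_cast hq
    _ = 5 / 2 := by norm_num


/-! ### Images of infinite words under morphisms -/

section Blocks

variable {A : Type*} {σ : Fin 3 → List A} {y : ℕ → Fin 3}

/-- The position in `σ (y)` at which the image of the letter `y i` begins. -/
def blockPos (σ : Fin 3 → List A) (y : ℕ → Fin 3) : ℕ → ℕ
  | 0 => 0
  | i + 1 => blockPos σ y i + (σ (y i)).length

theorem length_flatten_blocks (σ : Fin 3 → List A) (y : ℕ → Fin 3) (i : ℕ) :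
    ((List.range i).map fun t => σ (y t)).flatten.length = blockPos σ y i := by
  induction i with
  | zero => rfl
  | succ i ih => simp [List.range_succ, blockPos, ih, - List.length_flatten]

theorem blockPos_strictMono (hσ : ∀ a, σ a ≠ []) : StrictMono (blockPos σ y) :=
  strictMono_nat_of_lt_succ fun i => by
    have := List.length_pos_iff_ne_nil.mpr (hσ (y i))
    rw [blockPos]
    omega

theorem applyMorph_blockPos_add [Inhabited A] (hσ : ∀ a, σ a ≠ []) {i t : ℕ}
    (ht : t < (σ (y i)).length) :
    applyMorph σ y (blockPos σ y i + t) = (σ (y i)).getD t default := by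
  have hi : i ≤ blockPos σ y i := (blockPos_strictMono hσ).le_apply
  obtain ⟨k, hk⟩ := Nat.exists_eq_add_of_le (show i + 1 ≤ blockPos σ y i + t + 1 by omega)
  rw [applyMorph, hk, List.range_add, List.range_succ]
  simp only [List.map_append, List.flatten_append, List.map_cons, List.map_nil,
    List.flatten_cons, List.flatten_nil, List.append_nil, List.append_assoc]
  rw [List.getD_append_right _ _ _ _ (by rw [length_flatten_blocks]; omega),
    length_flatten_blocks, Nat.add_sub_cancel_left, List.getD_append _ _ _ _ ht]

theorem exists_blockPos_add (hσ : ∀ a, σ a ≠ []) (b : ℕ) :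
    ∃ i t, t < (σ (y i)).length ∧ b = blockPos σ y i + t := by
  induction b with
  | zero => exact ⟨0, 0, List.length_pos_iff_ne_nil.mpr (hσ _), rfl⟩
  | succ b ih =>
    obtain ⟨i, t, ht, rfl⟩ := ih
    rcases Nat.lt_or_ge (t + 1) (σ (y i)).length with h | h
    · exact ⟨i, t + 1, h, rfl⟩
    · exact ⟨i + 1, 0, List.length_pos_iff_ne_nil.mpr (hσ _), by rw [blockPos]; omega⟩

theorem Agree.image [Inhabited A] (hσ : ∀ a, σ a ≠ []) {S T m : ℕ} (h : Agree y S T m) :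
    ∃ L, m ≤ L ∧ blockPos σ y (S + m) = blockPos σ y S + L ∧
      blockPos σ y (T + m) = blockPos σ y T + L ∧
      Agree (applyMorph σ y) (blockPos σ y S) (blockPos σ y T) L := by
  induction m with
  | zero => exact ⟨0, le_rfl, rfl, rfl, fun t ht => by omega⟩
  | succ m ih =>
    obtain ⟨L, hL, hS, hT, hA⟩ := ih fun t ht => h t (by omega)
    have hm := h m (by omega)
    have hpos := List.length_pos_iff_ne_nil.mpr (hσ (y (S + m)))
    refine ⟨L + (σ (y (S + m))).length, by omega, ?_, ?_, fun t ht => ?_⟩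
    · rw [← add_assoc, blockPos, hS, add_assoc]
    · rw [← add_assoc, blockPos, hT, hm, add_assoc]
    · rcases Nat.lt_or_ge t L with htL | htL
      · exact hA t htL
      · obtain ⟨r, rfl⟩ := Nat.exists_eq_add_of_le htL
        rw [← add_assoc, ← add_assoc, ← hS, ← hT, applyMorph_blockPos_add hσ (by omega),
          applyMorph_blockPos_add hσ (by rw [← hm]; omega), hm]

theorem Agree.preimage [Inhabited A] (hσ : ∀ a, σ a ≠ [])
    (hdec : ∀ S T E F L, 0 < L → Agree (applyMorph σ y) (blockPos σ y S) (blockPos σ y T) L →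
      blockPos σ y E = blockPos σ y S + L → blockPos σ y F = blockPos σ y T + L → y S = y T)
    {S T E F L : ℕ} (h : Agree (applyMorph σ y) (blockPos σ y S) (blockPos σ y T) L)
    (hE : blockPos σ y E = blockPos σ y S + L) (hF : blockPos σ y F = blockPos σ y T + L) :
    ∃ m, E = S + m ∧ F = T + m ∧ Agree y S T m := by
  have hmono := blockPos_strictMono (y := y) hσ
  induction L using Nat.strong_induction_on generalizing S T with
  | _ L ih =>
    rcases Nat.eq_zero_or_pos L with rfl | hL
    · exact ⟨0, hmono.injective hE, hmono.injective hF, fun t ht => by omega⟩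
    · have hST := hdec S T E F L hL h hE hF
      have hSE : S + 1 ≤ E := hmono.lt_iff_lt.mp (by omega)
      have hle := hmono.monotone hSE
      have hpos := List.length_pos_iff_ne_nil.mpr (hσ (y S))
      rw [blockPos] at hle
      obtain ⟨m, hm1, hm2, hm3⟩ := ih (L - (σ (y S)).length) (by omega) (S := S + 1)
        (T := T + 1) (fun t ht => by
          have := h ((σ (y S)).length + t) (by omega)
          rw [blockPos, blockPos, ← hST, add_assoc, add_assoc]
          exact this) (by rw [blockPos]; omega) (by rw [blockPos, ← hST]; omega)
      refine ⟨m + 1, by omega, by omega, fun t ht => ?_⟩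
      cases t with
      | zero => exact hST
      | succ t =>
        have := hm3 t (by omega)
        rwa [add_assoc, add_assoc, add_comm 1 t] at this

end Blocks

/-! ### The fixed point of `hm` -/

theorem mapWord_append {k : ℕ} {A : Type*} (σ : Fin k → List A) (u v : List (Fin k)) :
    mapWord σ (u ++ v) = mapWord σ u ++ mapWord σ v := by
  simp [mapWord]

theorem hm_ne_nil : ∀ a, hm a ≠ [] := by decide

theorem gm_ne_nil : ∀ a, gm a ≠ [] := by decide

/-- The iterates of `hm` at the letter `0`. -/
def hmIter (n : ℕ) : List (Fin 3) := (mapWord hm)^[n] [0]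

theorem hmIter_succ (n : ℕ) : hmIter (n + 1) = mapWord hm (hmIter n) :=
  Function.iterate_succ_apply' _ _ _

theorem length_le_length_mapWord_hm (u : List (Fin 3)) : u.length ≤ (mapWord hm u).length := by
  induction u with
  | nil => simp
  | cons a u ih =>
    have := List.length_pos_iff_ne_nil.mpr (hm_ne_nil a)
    have h : mapWord hm (a :: u) = hm a ++ mapWord hm u := rfl
    rw [h, List.length_append, List.length_cons]
    omega

theorem hmIter_succ_eq_append (n : ℕ) : ∃ v, v ≠ [] ∧ hmIter (n + 1) = hmIter n ++ v := by
  induction n with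
  | zero => exact ⟨[1], by simp, rfl⟩
  | succ n ih =>
    obtain ⟨v, hv, h⟩ := ih
    refine ⟨mapWord hm v, ?_, ?_⟩
    · rw [← List.length_pos_iff_ne_nil] at hv ⊢
      exact hv.trans_le (length_le_length_mapWord_hm v)
    · rw [hmIter_succ, h, mapWord_append, ← h, ← hmIter_succ]

theorem lt_length_hmIter (n : ℕ) : n < (hmIter n).length := by
  induction n with
  | zero => exact Nat.one_pos
  | succ n ih =>
    obtain ⟨v, hv, h⟩ := hmIter_succ_eq_append n
    have := List.length_pos_iff_ne_nil.mpr hv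
    rw [h, List.length_append]
    omega

theorem hmIter_prefix {m n : ℕ} (h : m ≤ n) : hmIter m <+: hmIter n := by
  induction n, h using Nat.le_induction with
  | base => exact List.prefix_rfl
  | succ n _ ih =>
    obtain ⟨v, -, h⟩ := hmIter_succ_eq_append n
    exact ih.trans ⟨v, h.symm⟩

/-- The fixed point `0121021010210…` of the morphism `hm`. -/
def tern (n : ℕ) : Fin 3 := (hmIter n).getD n default

theorem getD_eq_of_prefix {A : Type*} {u v : List A} (h : u <+: v) {n : ℕ} (hn : n < u.length)
    (d : A) : v.getD n d = u.getD n d := by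
  obtain ⟨w, rfl⟩ := h
  exact List.getD_append _ _ _ _ hn

theorem getD_hmIter {m n : ℕ} (h : n < (hmIter m).length) :
    (hmIter m).getD n default = tern n := by
  rcases le_total m n with hmn | hmn
  · exact (getD_eq_of_prefix (hmIter_prefix hmn) h _).symm
  · exact getD_eq_of_prefix (hmIter_prefix hmn) (lt_length_hmIter n) _

theorem map_tern_range (n : ℕ) : (List.range (n + 1)).map tern = (hmIter n).take (n + 1) := by
  have hlen := lt_length_hmIter n
  refine List.ext_getElem (by simp; omega) fun t h1 h2 => ?_
  rw [List.length_map, List.length_range] at h1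
  rw [List.getElem_map, List.getElem_range, List.getElem_take,
    ← getD_hmIter (show t < (hmIter n).length by omega),
    List.getD_eq_getElem _ _ (show t < (hmIter n).length by omega)]

theorem applyMorph_hm_tern : applyMorph hm tern = tern := by
  funext n
  have h : ((List.range (n + 1)).map fun i => hm (tern i)).flatten
      = mapWord hm ((hmIter n).take (n + 1)) := by
    rw [← map_tern_range, mapWord, List.map_map]
    rfl
  have hpre : mapWord hm ((hmIter n).take (n + 1)) <+: hmIter (n + 1) := by
    refine ⟨mapWord hm ((hmIter n).drop (n + 1)), ?_⟩
    rw [← mapWord_append, List.take_append_drop, hmIter_succ]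
  have hlen : n < (mapWord hm ((hmIter n).take (n + 1))).length := by
    refine lt_of_lt_of_le ?_ (length_le_length_mapWord_hm _)
    rw [List.length_take]
    have := lt_length_hmIter n
    omega
  rw [applyMorph, h, ← getD_eq_of_prefix hpre hlen,
    getD_hmIter (hlen.trans_le hpre.length_le)]

/-- The image of the fixed point of `hm` under `gm`. -/
def rote : ℕ → Fin 2 := applyMorph gm tern

/-- Starting positions of the blocks `hm (tern i)` in `tern`. -/
abbrev hpos : ℕ → ℕ := blockPos hm tern

/-- Starting positions of the blocks `gm (tern i)` in `rote`. -/
abbrev gpos : ℕ → ℕ := blockPos gm tern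

theorem hpos_strictMono : StrictMono hpos := blockPos_strictMono hm_ne_nil

theorem gpos_strictMono : StrictMono gpos := blockPos_strictMono gm_ne_nil

theorem tern_hpos_add {i t : ℕ} (ht : t < (hm (tern i)).length) :
    tern (hpos i + t) = (hm (tern i)).getD t default := by
  conv_lhs => rw [← applyMorph_hm_tern]
  exact applyMorph_blockPos_add hm_ne_nil ht

theorem hm_block (i : ℕ) :
    (tern i = 0 ∧ hpos (i + 1) = hpos i + 2 ∧ tern (hpos i) = 0 ∧ tern (hpos i + 1) = 1) ∨
    (tern i = 1 ∧ hpos (i + 1) = hpos i + 2 ∧ tern (hpos i) = 2 ∧ tern (hpos i + 1) = 1) ∨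
    (tern i = 2 ∧ hpos (i + 1) = hpos i + 1 ∧ tern (hpos i) = 0) := by
  have h := @tern_hpos_add i
  have hs : hpos (i + 1) = hpos i + (hm (tern i)).length := rfl
  generalize tern i = a at h hs
  fin_cases a
  · exact Or.inl ⟨rfl, hs, h (t := 0) (by decide), h (t := 1) (by decide)⟩
  · exact Or.inr (Or.inl ⟨rfl, hs, h (t := 0) (by decide), h (t := 1) (by decide)⟩)
  · exact Or.inr (Or.inr ⟨rfl, hs, h (t := 0) (by decide)⟩)

theorem gm_block (i : ℕ) :
    (tern i = 0 ∧ gpos (i + 1) = gpos i + 3 ∧ rote (gpos i) = 0 ∧ rote (gpos i + 1) = 1 ∧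
      rote (gpos i + 2) = 1) ∨
    (tern i = 1 ∧ gpos (i + 1) = gpos i + 1 ∧ rote (gpos i) = 0) ∨
    (tern i = 2 ∧ gpos (i + 1) = gpos i + 2 ∧ rote (gpos i) = 0 ∧ rote (gpos i + 1) = 1) := by
  have h : ∀ {t}, t < (gm (tern i)).length →
      rote (gpos i + t) = (gm (tern i)).getD t default :=
    applyMorph_blockPos_add gm_ne_nil
  have hs : gpos (i + 1) = gpos i + (gm (tern i)).length := rfl
  generalize tern i = a at h hs
  fin_cases a
  · exact Or.inl ⟨rfl, hs, h (t := 0) (by decide), h (t := 1) (by decide),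
      h (t := 2) (by decide)⟩
  · exact Or.inr (Or.inl ⟨rfl, hs, h (t := 0) (by decide)⟩)
  · exact Or.inr (Or.inr ⟨rfl, hs, h (t := 0) (by decide), h (t := 1) (by decide)⟩)

theorem exists_hpos_add (b : ℕ) : ∃ i, b = hpos i ∨ (b = hpos i + 1 ∧ tern b = 1 ∧
    hpos (i + 1) = hpos i + 2 ∧ tern i ≠ 2) := by
  obtain ⟨i, t, ht, rfl⟩ := exists_blockPos_add (y := tern) hm_ne_nil b
  refine ⟨i, ?_⟩
  have hs : hpos (i + 1) = hpos i + (hm (tern i)).length := rfl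
  rcases hm_block i with ⟨h, h1, -, h2⟩ | ⟨h, h1, -, h2⟩ | ⟨h, h1, -⟩
  · obtain rfl | rfl : t = 0 ∨ t = 1 := by omega
    · exact Or.inl rfl
    · exact Or.inr ⟨rfl, h2, h1, by rw [h]; decide⟩
  · obtain rfl | rfl : t = 0 ∨ t = 1 := by omega
    · exact Or.inl rfl
    · exact Or.inr ⟨rfl, h2, h1, by rw [h]; decide⟩
  · obtain rfl : t = 0 := by omega
    exact Or.inl rfl

theorem exists_hpos_eq {b : ℕ} (h : tern b ≠ 1) : ∃ i, b = hpos i := by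
  obtain ⟨i, hi | ⟨-, hi, -⟩⟩ := exists_hpos_add b
  · exact ⟨i, hi⟩
  · exact absurd hi h

theorem exists_gpos_eq {b : ℕ} (h : rote b = 0) : ∃ i, b = gpos i := by
  obtain ⟨i, t, ht, rfl⟩ := exists_blockPos_add (y := tern) gm_ne_nil b
  refine ⟨i, ?_⟩
  have hs : gpos (i + 1) = gpos i + (gm (tern i)).length := rfl
  rcases gm_block i with ⟨-, h1, -, h2, h3⟩ | ⟨-, h1, -⟩ | ⟨-, h1, -, h2⟩
  · obtain rfl | rfl | rfl : t = 0 ∨ t = 1 ∨ t = 2 := by omega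
    · rfl
    · exact absurd (h.symm.trans h2) (by decide)
    · exact absurd (h.symm.trans h3) (by decide)
  · obtain rfl : t = 0 := by omega
    rfl
  · obtain rfl | rfl : t = 0 ∨ t = 1 := by omega
    · rfl
    · exact absurd (h.symm.trans h2) (by decide)

theorem tern_hpos_ne_one (i : ℕ) : tern (hpos i) ≠ 1 := by
  rcases hm_block i with ⟨-, -, h, -⟩ | ⟨-, -, h, -⟩ | ⟨-, -, h⟩ <;> rw [h] <;> decide

theorem rote_gpos (i : ℕ) : rote (gpos i) = 0 := by
  rcases gm_block i with ⟨-, -, h, -⟩ | ⟨-, -, h⟩ | ⟨-, -, h, -⟩ <;> exact h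

theorem tern_zero : tern 0 = 0 := rfl

/-- The pairs of letters that occur next to each other in `tern`. -/
def Adjacent (a b : Fin 3) : Prop :=
  a ≠ b ∧ (a = 2 → b = 1)

instance (a b : Fin 3) : Decidable (Adjacent a b) := inferInstanceAs (Decidable (_ ∧ _))

theorem adjacent_tern (i : ℕ) : Adjacent (tern i) (tern (i + 1)) := by
  induction i using Nat.strong_induction_on with
  | _ i ih =>
    obtain ⟨k, rfl | ⟨h, h1, h2, h3⟩⟩ := exists_hpos_add i
    · rcases hm_block k with ⟨-, -, h1, h2⟩ | ⟨-, -, h1, h2⟩ | ⟨h, h1, h2⟩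
      · rw [h1, h2]; decide
      · rw [h1, h2]; decide
      · have hk : k < hpos k := by
          rcases Nat.eq_zero_or_pos k with rfl | hk
          · exact absurd (h.symm.trans tern_zero) (by decide)
          · have h0 : hpos 1 = 2 := rfl
            have := hpos_strictMono.add_le_nat (k - 1) 1
            rw [show k - 1 + 1 = k by omega] at this
            omega
        have hadj := ih k hk
        rw [← h1, h2]
        have hk1 : tern (k + 1) = 1 := hadj.2 h
        rcases hm_block (k + 1) with ⟨h5, -⟩ | ⟨-, -, h5, -⟩ | ⟨h5, -⟩
        · exact absurd (h5.symm.trans hk1) (by decide)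
        · rw [h5]; decide
        · exact absurd (h5.symm.trans hk1) (by decide)
    · rw [h1]
      have : i + 1 = hpos (k + 1) := by omega
      rw [this]
      exact ⟨(tern_hpos_ne_one _).symm, fun h => absurd h (by decide)⟩


theorem tern_preimage {S T E F L : ℕ} (h : Agree tern (hpos S) (hpos T) L)
    (hE : hpos E = hpos S + L) (hF : hpos F = hpos T + L) :
    ∃ m, E = S + m ∧ F = T + m ∧ Agree tern S T m := by
  rw [← applyMorph_hm_tern] at h
  refine Agree.preimage hm_ne_nil ?_ h hE hF
  rw [applyMorph_hm_tern]
  intro S T E F L hL h hE hF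
  have h0 := h 0 hL
  rw [add_zero, add_zero] at h0
  have key : ∀ S T E F, hpos E = hpos S + L → hpos F = hpos T + L →
      Agree tern (hpos S) (hpos T) L → tern S = 0 → tern T = 2 → False := by
    intro S T E F hE hF h hS hT
    rcases hm_block S with ⟨-, hS1, -, hS2⟩ | ⟨hc, -⟩ | ⟨hc, -⟩
    · rcases hm_block T with ⟨hc, -⟩ | ⟨hc, -⟩ | ⟨-, hT1, -⟩
      · exact absurd (hc.symm.trans hT) (by decide)
      · exact absurd (hc.symm.trans hT) (by decide)
      · have hSE : S + 1 ≤ E := hpos_strictMono.lt_iff_lt.mp (show hpos S < hpos E by omega)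
        have hle : hpos (S + 1) ≤ hpos E := hpos_strictMono.monotone hSE
        have h1 := h 1 (by omega)
        exact tern_hpos_ne_one (T + 1) (by rw [hT1, ← h1, hS2])
    · exact absurd (hc.symm.trans hS) (by decide)
    · exact absurd (hc.symm.trans hS) (by decide)
  have k1 := key S T E F hE hF h
  have k2 := key T S F E hF hE fun t ht => (h t ht).symm
  rcases hm_block S with ⟨hS, -, hS0, -⟩ | ⟨hS, -, hS0, -⟩ | ⟨hS, -, hS0⟩ <;>
  rcases hm_block T with ⟨hT, -, hT0, -⟩ | ⟨hT, -, hT0, -⟩ | ⟨hT, -, hT0⟩ <;>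
  simp_all

theorem rote_preimage {S T E F L : ℕ} (h : Agree rote (gpos S) (gpos T) L)
    (hE : gpos E = gpos S + L) (hF : gpos F = gpos T + L) :
    ∃ m, E = S + m ∧ F = T + m ∧ Agree tern S T m := by
  refine Agree.preimage gm_ne_nil ?_ h hE hF
  intro S T E F L hL h hE hF
  have h' : Agree rote (gpos S) (gpos T) (L + 1) := by
    intro t ht
    rcases Nat.lt_succ_iff_lt_or_eq.mp ht with ht | rfl
    · exact h t ht
    · rw [← hE, ← hF, rote_gpos, rote_gpos]
  have key : ∀ S E, gpos E = gpos S + L → gpos (S + 1) ≤ gpos S + L := by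
    intro S E hE
    have hSE : S + 1 ≤ E := gpos_strictMono.lt_iff_lt.mp (show gpos S < gpos E by omega)
    exact hE ▸ gpos_strictMono.monotone hSE
  have k1 := key S E hE
  have k2 := key T F hF
  have e1 := h' 1 (by omega)
  have e2 := h' 2
  have b1 := rote_gpos (S + 1)
  have b2 := rote_gpos (T + 1)
  rcases gm_block S with ⟨hS, hS1, -, hS2, hS3⟩ | ⟨hS, hS1, -⟩ | ⟨hS, hS1, -, hS2⟩ <;>
  rcases gm_block T with ⟨hT, hT1, -, hT2, hT3⟩ | ⟨hT, hT1, -⟩ | ⟨hT, hT1, -, hT2⟩ <;>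
  rw [hS, hT] <;> rw [hS1] at b1 k1 <;> rw [hT1] at b2 k2 <;> exfalso
  · rw [hS2, b2] at e1; exact absurd e1 (by decide)
  · rw [hS3, b2] at e2; exact absurd (e2 (by omega)) (by decide)
  · rw [b1, hT2] at e1; exact absurd e1 (by decide)
  · rw [b1, hT2] at e1; exact absurd e1 (by decide)
  · rw [b1, hT3] at e2; exact absurd (e2 (by omega)) (by decide)
  · rw [hS2, b2] at e1; exact absurd e1 (by decide)

/-! ### Extensions of factors of the fixed point

A quadruple of occurrences of a factor whose left neighbours separate the first two occurrences
from the last two, and whose right neighbours separate the even ones from the odd ones,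
would be a bispecial factor with too many extensions. -/

/-- The first two letters are separated from the last two, in a manner compatible with `hm`. -/
def LeftSep (a : Fin 4 → Fin 3) : Prop :=
  a 0 ≠ a 2 ∧ a 0 ≠ a 3 ∧ a 1 ≠ a 2 ∧ a 1 ≠ a 3 ∧
    (a 0 = a 1 ∨ a 0 = 0 ∨ a 1 = 0) ∧ (a 2 = a 3 ∨ a 2 = 0 ∨ a 3 = 0)

/-- The letters with even index are all `0` and those with odd index are all `2`,
or the other way round. -/
def RightSepA (c : Fin 4 → Fin 3) : Prop :=
  c 0 = c 2 ∧ c 1 = c 3 ∧ c 0 ≠ 1 ∧ c 1 ≠ 1 ∧ c 0 ≠ c 1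

/-- The letters equal to `1` are exactly those with even index, or exactly those with odd
index. -/
def RightSepB (c : Fin 4 → Fin 3) : Prop :=
  (c 0 = 1 ↔ c 2 = 1) ∧ (c 1 = 1 ↔ c 3 = 1) ∧ ¬(c 0 = 1 ↔ c 1 = 1)

theorem LeftSep.of_suffix {a t : Fin 4 → Fin 3} (h : LeftSep a)
    (hat : ∀ k, (t k ≠ 2 ∧ a k = 1) ∨ (t k = 2 ∧ a k = 0)) : LeftSep t := by
  have h0 := hat 0
  have h1 := hat 1
  have h2 := hat 2
  have h3 := hat 3
  unfold LeftSep at *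
  grind

theorem LeftSep.of_one {a t : Fin 4 → Fin 3} (h : LeftSep a)
    (hat : ∀ k, (t k = 0 ∧ a k = 0) ∨ (t k = 1 ∧ a k = 2)) : LeftSep t := by
  have h0 := hat 0
  have h1 := hat 1
  have h2 := hat 2
  have h3 := hat 3
  unfold LeftSep at *
  grind

theorem exists_desubst_left {s : Fin 4 → ℕ} (hl : LeftSep fun k => tern (s k))
    (h : ∀ k, tern (s 0 + 1) = tern (s k + 1)) :
    ∃ (T : Fin 4 → ℕ) (δ : ℕ), δ ≤ 1 ∧ (∀ k, hpos (T k + 1) = s k + 1 + δ) ∧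
      (LeftSep fun k => tern (T k)) ∧ (δ = 1 → ∀ k, tern (s k + 1) = 1) := by
  by_cases hw : tern (s 0 + 1) = 1
  · have key : ∀ k, ∃ T, hpos (T + 1) = s k + 2 ∧
        ((tern T = 0 ∧ tern (s k) = 0) ∨ (tern T = 1 ∧ tern (s k) = 2)) := by
      intro k
      have h1 : tern (s k + 1) = 1 := (h k).symm.trans hw
      have hne : tern (s k) ≠ 1 := fun hc => (adjacent_tern (s k)).1 (hc.trans h1.symm)
      obtain ⟨T, hT⟩ := exists_hpos_eq hne
      refine ⟨T, ?_⟩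
      rw [hT] at h1 ⊢
      rcases hm_block T with ⟨h2, h3, h4, -⟩ | ⟨h2, h3, h4, -⟩ | ⟨-, h3, -⟩
      · exact ⟨h3, Or.inl ⟨h2, h4⟩⟩
      · exact ⟨h3, Or.inr ⟨h2, h4⟩⟩
      · exact absurd (h3 ▸ h1) (tern_hpos_ne_one _)
    choose T hT1 hT2 using key
    exact ⟨T, 1, le_rfl, hT1, hl.of_one hT2, fun _ k => (h k).symm.trans hw⟩
  · have key : ∀ k, ∃ T, hpos (T + 1) = s k + 1 ∧
        ((tern T ≠ 2 ∧ tern (s k) = 1) ∨ (tern T = 2 ∧ tern (s k) = 0)) := by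
      intro k
      obtain ⟨U, hU⟩ := exists_hpos_eq (b := s k + 1) (by rwa [← h k])
      cases U with
      | zero => exact absurd hU (by rw [show hpos 0 = 0 from rfl]; omega)
      | succ T =>
        refine ⟨T, hU.symm, ?_⟩
        rcases hm_block T with ⟨h2, h3, -, h4⟩ | ⟨h2, h3, -, h4⟩ | ⟨h2, h3, h4⟩
        · rw [show s k = hpos T + 1 by omega, h2, h4]; decide
        · rw [show s k = hpos T + 1 by omega, h2, h4]; decide
        · rw [show s k = hpos T by omega, h2, h4]; decide
    choose T hT1 hT2 using key
    exact ⟨T, 0, Nat.zero_le _, hT1, hl.of_suffix hT2, fun h => absurd h (by decide)⟩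

theorem not_separated_tern (n : ℕ) (s : Fin 4 → ℕ) (hl : LeftSep fun k => tern (s k))
    (h : ∀ k, Agree tern (s 0 + 1) (s k + 1) n) :
    ¬ RightSepB (fun k => tern (s k + 1 + n)) ∧ ¬ RightSepA (fun k => tern (s k + 1 + n)) := by
  induction n using Nat.strong_induction_on generalizing s with
  | _ n ih =>
    have glue : ∀ (s T E : Fin 4 → ℕ) (δ L : ℕ), (∀ k, hpos (T k + 1) = s k + 1 + δ) →
        (∀ k, Agree tern (s 0 + 1) (s k + 1) (δ + L)) → (∀ k, hpos (E k) = s k + 1 + δ + L) →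
        ∃ m ≤ L, (∀ k, E k = T k + 1 + m) ∧ ∀ k, Agree tern (T 0 + 1) (T k + 1) m := by
      intro s T E δ L hT h hE
      have key : ∀ k, ∃ m, E 0 = T 0 + 1 + m ∧ E k = T k + 1 + m ∧
          Agree tern (T 0 + 1) (T k + 1) m := by
        intro k
        refine tern_preimage (L := L) (fun t ht => ?_) (by rw [hE, hT]) (by rw [hE, hT])
        rw [hT, hT, add_assoc, add_assoc _ δ t]
        exact h k (δ + t) (by omega)
      obtain ⟨m, hm0, -, -⟩ := key 0
      have hmL := hpos_strictMono.add_le_nat m (T 0 + 1)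
      rw [add_comm m (T 0 + 1), ← hm0, hE, hT] at hmL
      refine ⟨m, by omega, fun k => ?_, fun k => ?_⟩ <;>
      · obtain ⟨m', h1, h2, h3⟩ := key k
        obtain rfl : m = m' := by omega
        assumption
    have hB : ∀ s : Fin 4 → ℕ, (LeftSep fun k => tern (s k)) →
        (∀ k, Agree tern (s 0 + 1) (s k + 1) n) →
        ¬ RightSepB (fun k => tern (s k + 1 + n)) := by
      intro s hl h hr
      rcases Nat.eq_zero_or_pos n with rfl | hn
      · have a0 := adjacent_tern (s 0)
        have a1 := adjacent_tern (s 1)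
        have a2 := adjacent_tern (s 2)
        have a3 := adjacent_tern (s 3)
        unfold LeftSep at hl
        unfold RightSepB at hr
        unfold Adjacent at a0 a1 a2 a3
        simp only [add_zero] at hr
        grind
      · obtain ⟨T, δ, hδ, hT, hTl, hδ1⟩ := exists_desubst_left hl fun k => h k 0 hn
        obtain ⟨r, rfl⟩ := Nat.exists_eq_add_of_le' hn
        have hlast : ∀ k, tern (s k + 1 + r) = 0 := by
          have b0 := adjacent_tern (s 0 + 1 + r)
          have b1 := adjacent_tern (s 1 + 1 + r)
          have e1 := h 1 r (by omega)
          have : tern (s 0 + 1 + r) = 0 := by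
            unfold RightSepB at hr
            unfold Adjacent at b0 b1
            simp only [← add_assoc] at hr
            grind
          intro k
          rw [← h k r (by omega), this]
        have key : ∀ k, ∃ E, hpos E = s k + 1 + r ∧
            ((tern E = 0 ∧ tern (s k + 1 + (r + 1)) = 1) ∨
              (tern E = 2 ∧ tern (s k + 1 + (r + 1)) ≠ 1)) := by
          intro k
          obtain ⟨E, hE⟩ := exists_hpos_eq (b := s k + 1 + r) (by rw [hlast]; decide)
          refine ⟨E, hE.symm, ?_⟩
          rw [← add_assoc]
          have hk := hlast k
          rw [hE] at hk ⊢
          rcases hm_block E with ⟨h1, -, -, h2⟩ | ⟨-, -, h1, -⟩ | ⟨h1, h2, -⟩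
          · exact Or.inl ⟨h1, h2⟩
          · exact absurd (hk.symm.trans h1) (by decide)
          · exact Or.inr ⟨h1, h2 ▸ tern_hpos_ne_one _⟩
        choose E hE hE' using key
        have hδr : δ ≤ r := by
          by_contra hc
          have h1 := hδ1 (by omega) 0
          have h2 := hlast 0
          rw [show r = 0 by omega, add_zero, h1] at h2
          exact absurd h2 (by decide)
        obtain ⟨L, rfl⟩ := Nat.exists_eq_add_of_le hδr
        obtain ⟨m, hmL, hm1, hm2⟩ := glue s T E δ L hT
          (fun k t ht => h k t (by omega)) (fun k => by rw [hE, add_assoc _ δ L])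
        refine (ih m (by omega) T hTl hm2).2 ?_
        simp only [← hm1]
        have e0 := hE' 0
        have e1 := hE' 1
        have e2 := hE' 2
        have e3 := hE' 3
        unfold RightSepB at hr
        unfold RightSepA
        grind
    refine ⟨hB s hl h, fun hr => ?_⟩
    rcases Nat.eq_zero_or_pos n with rfl | hn
    · have a0 := adjacent_tern (s 0)
      have a1 := adjacent_tern (s 1)
      have a2 := adjacent_tern (s 2)
      have a3 := adjacent_tern (s 3)
      unfold LeftSep at hl
      unfold RightSepA at hr
      unfold Adjacent at a0 a1 a2 a3
      simp only [add_zero] at hr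
      grind
    · obtain ⟨T, δ, hδ, hT, hTl, -⟩ := exists_desubst_left hl fun k => h k 0 hn
      have hne : ∀ k, tern (s k + 1 + n) ≠ 1 := by
        unfold RightSepA at hr
        simp only [Fin.forall_fin_succ]
        grind
      have key : ∀ k, ∃ E, hpos E = s k + 1 + n ∧ (tern E = 1 ↔ tern (s k + 1 + n) = 2) := by
        intro k
        obtain ⟨E, hE⟩ := exists_hpos_eq (hne k)
        refine ⟨E, hE.symm, ?_⟩
        rw [hE]
        rcases hm_block E with ⟨h1, -, h2, -⟩ | ⟨h1, -, h2, -⟩ | ⟨h1, -, h2⟩ <;>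
        rw [h1, h2] <;> decide
      choose E hE hE' using key
      obtain ⟨L, rfl⟩ := Nat.exists_eq_add_of_le (show δ ≤ n by omega)
      obtain ⟨m, hmL, hm1, hm2⟩ := glue s T E δ L hT h
        (fun k => by rw [hE, add_assoc _ δ L])
      have hrB : RightSepB fun k => tern (T k + 1 + m) := by
        simp only [← hm1]
        unfold RightSepA at hr
        unfold RightSepB
        grind
      rcases Nat.lt_or_ge m (δ + L) with hlt | hge
      · exact (ih m hlt T hTl hm2).1 hrB
      · obtain rfl : m = δ + L := by omega
        exact hB T hTl hm2 hrB


/-! ### Runs in the fixed point -/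

theorem hpos_add_three_le (i : ℕ) : hpos i + 3 ≤ hpos (i + 2) := by
  have h := adjacent_tern i
  unfold Adjacent at h
  have h1 := hm_block i
  have h2 := hm_block (i + 1)
  rw [add_assoc] at h2
  norm_num at h2
  grind

theorem sub_lt_hpos_sub {i j : ℕ} (h : i + 2 ≤ j) : j - i < hpos j - hpos i := by
  obtain ⟨k, rfl⟩ := Nat.exists_eq_add_of_le h
  have h1 := hpos_add_three_le i
  have h2 := hpos_strictMono.add_le_nat k (i + 2)
  rw [add_comm k (i + 2)] at h2
  omega

theorem exists_first_mismatch {A : Type*} {x : ℕ → A} {i j : ℕ}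
    (h : ∃ t, x (i + t) ≠ x (j + t)) : ∃ m, Agree x i j m ∧ x (i + m) ≠ x (j + m) := by
  classical
  exact ⟨Nat.find h, fun t ht => not_not.mp (Nat.find_min h ht), Nat.find_spec h⟩

theorem Agree.eq_of_mismatch {A : Type*} {x : ℕ → A} {i j m n : ℕ} (hm : Agree x i j m)
    (hm' : x (i + m) ≠ x (j + m)) (hn : Agree x i j n) (hn' : x (i + n) ≠ x (j + n)) :
    m = n := by
  rcases lt_trichotomy m n with h | h | h
  · exact absurd (hn m h) hm'
  · exact h
  · exact absurd (hm n h) hn'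

theorem exists_tern_mismatch {i j : ℕ} (h : i < j) : ∃ t, tern (i + t) ≠ tern (j + t) := by
  by_contra! hc
  obtain ⟨d, hd⟩ : ∃ d, d = j - i := ⟨_, rfl⟩
  induction d using Nat.strong_induction_on generalizing i j with
  | _ d ih =>
    obtain ⟨δ, hδ⟩ : ∃ δ, tern (i + δ) ≠ 1 := by
      by_cases h1 : tern i = 1
      · exact ⟨1, fun h2 => (adjacent_tern i).1 (h1.trans h2.symm)⟩
      · exact ⟨0, h1⟩
    obtain ⟨I, hI⟩ := exists_hpos_eq hδ
    obtain ⟨J, hJ⟩ := exists_hpos_eq (hc δ ▸ hδ)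
    have hall : ∀ m, tern (I + m) = tern (J + m) := by
      intro m
      obtain ⟨L, hL⟩ := Nat.exists_eq_add_of_le
        (hpos_strictMono.monotone (show I ≤ I + m + 1 by omega))
      have hag : ∀ t, tern (hpos I + t) = tern (hpos J + t) := fun t => by
        rw [← hI, ← hJ, add_assoc, add_assoc, hc]
      obtain ⟨F, hF⟩ := exists_hpos_eq (b := hpos J + L)
        (by rw [← hag, ← hL]; exact tern_hpos_ne_one _)
      obtain ⟨m', h1, -, h3⟩ := tern_preimage (fun t _ => hag t) hL hF.symm
      exact h3 m (by omega)
    have hIJ : I < J := hpos_strictMono.lt_iff_lt.mp (by omega)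
    rcases Nat.lt_or_ge (I + 1) J with h2 | h2
    · have := sub_lt_hpos_sub h2
      exact ih (J - I) (by omega) hIJ hall rfl
    · obtain rfl : J = I + 1 := by omega
      exact (adjacent_tern I).1 (hall 0)

/-- The number of occurrences of the letter `c` in the prefix of length `i` of `tern`. -/
def letterCount (c : Fin 3) : ℕ → ℤ
  | 0 => 0
  | i + 1 => letterCount c i + if tern i = c then 1 else 0

theorem letterCount_hpos (i : ℕ) :
    letterCount 0 (hpos i) = letterCount 0 i + letterCount 2 i ∧
    letterCount 1 (hpos i) = letterCount 0 i + letterCount 1 i ∧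
    letterCount 2 (hpos i) = letterCount 1 i := by
  induction i with
  | zero => exact ⟨rfl, rfl, rfl⟩
  | succ i ih =>
    obtain ⟨h0, h1, h2⟩ := ih
    rcases hm_block i with ⟨h, hs, a, b⟩ | ⟨h, hs, a, b⟩ | ⟨h, hs, a⟩ <;>
    · rw [hs]
      simp [letterCount, *]
      try omega

theorem gpos_eq (i : ℕ) :
    (gpos i : ℤ) = 3 * letterCount 0 i + letterCount 1 i + 2 * letterCount 2 i := by
  induction i with
  | zero => rfl
  | succ i ih =>
    rcases gm_block i with ⟨h, hs, -⟩ | ⟨h, hs, -⟩ | ⟨h, hs, -⟩ <;>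
    · rw [hs]
      simp [letterCount, h]
      omega

theorem letterCount_mono (c : Fin 3) : Monotone (letterCount c) :=
  monotone_nat_of_le_succ fun i => by
    rw [letterCount]
    split_ifs <;> omega

/-- A maximal pair of equal blocks of `tern`: the blocks of length `n` at `i < j` agree and
cannot be extended on either side. -/
structure IsRun (i j n : ℕ) : Prop where
  lt : i < j
  agree : Agree tern i j n
  right : tern (i + n) ≠ tern (j + n)
  left : i = 0 ∨ tern (i - 1) ≠ tern (j - 1)

/-- The letters preceding the two blocks of a run: their sum, or `3` if the first block is a
prefix. A pair of distinct letters is determined by its sum in `Fin 3`. -/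
def leftType (i j : ℕ) : Fin 4 :=
  if i = 0 then 3 else (tern (i - 1) + tern (j - 1)).castSucc

/-- The data attached to a run: three times the letter counts of its period minus twice the
letter counts of the repeated block, and the types of the letters around it. -/
@[ext] structure RunState where
  a : ℤ
  b : ℤ
  c : ℤ
  l : Fin 4
  r : Fin 3

/-- The state of a run. -/
def runState (i j n : ℕ) : RunState where
  a := 3 * (letterCount 0 j - letterCount 0 i) - 2 * (letterCount 0 (i + n) - letterCount 0 i)
  b := 3 * (letterCount 1 j - letterCount 1 i) - 2 * (letterCount 1 (i + n) - letterCount 1 i)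
  c := 3 * (letterCount 2 j - letterCount 2 i) - 2 * (letterCount 2 (i + n) - letterCount 2 i)
  l := leftType i j
  r := tern (i + n) + tern (j + n)

namespace RunState

/-- The effect of `hm` on the state of a run. -/
def step (s : RunState) : RunState where
  a := s.a + s.c - 2 * if s.r = 2 then 1 else 0
  b := s.a + s.b - 2 * if s.l = 1 then 1 else 0
  c := s.b
  l := ![1, 2, 1, 3] s.l
  r := ![2, 2, 0] s.r

/-- Three times the period minus twice the length of the repeated block, for the run obtained
by applying `gm`. -/
def excess (s : RunState) : ℤ :=
  3 * s.a + s.b + 2 * s.c - 2 * ((if s.l = 2 then 1 else 0) + 1 + if s.r = 2 then 1 else 0)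

/-- The run and all its images under `hm` have nonnegative excess. -/
def Good (s : RunState) : Prop := ∀ k, 0 ≤ (step^[k] s).excess

theorem Good.step {s : RunState} (h : s.Good) : s.step.Good := fun k => h (k + 1)

theorem good_iff {s : RunState} : s.Good ↔ 0 ≤ s.excess ∧ s.step.Good :=
  ⟨fun h => ⟨h 0, h.step⟩, fun h k => k.casesOn h.1 h.2⟩

/-- A region that is preserved by `step`. -/
def Large (s : RunState) : Prop :=
  12 ≤ 3 * s.a + s.b + 2 * s.c ∧ 8 ≤ s.a + 2 * s.b + s.c ∧ 14 ≤ 3 * s.a + 3 * s.b + s.c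

instance (s : RunState) : Decidable s.Large := inferInstanceAs (Decidable (_ ∧ _ ∧ _))

theorem Large.step {s : RunState} (h : s.Large) : s.step.Large := by
  obtain ⟨h0, h1, h2⟩ := h
  refine ⟨?_, ?_, ?_⟩ <;> simp only [RunState.step] <;> split_ifs <;> omega

theorem Large.good {s : RunState} (h : s.Large) : s.Good := by
  intro k
  have hk : (RunState.step^[k] s).Large := by
    induction k with
    | zero => exact h
    | succ k ih => rw [Function.iterate_succ_apply']; exact ih.step
  obtain ⟨h0, -, -⟩ := hk
  rw [excess]
  split_ifs <;> omega

/-- Checks that the first `k` images have nonnegative excess and the next one is large. -/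
def check (s : RunState) : ℕ → Bool
  | 0 => decide s.Large
  | k + 1 => decide (0 ≤ s.excess) && s.step.check k

theorem good_of_check {s : RunState} {k : ℕ} (h : s.check k = true) : s.Good := by
  induction k generalizing s with
  | zero => exact (of_decide_eq_true h : s.Large).good
  | succ k ih =>
    rw [check, Bool.and_eq_true] at h
    exact good_iff.mpr ⟨of_decide_eq_true h.1, ih h.2⟩

theorem Good.mono {s t : RunState} (h : s.Good) (ha : s.a ≤ t.a) (hb : s.b ≤ t.b)
    (hc : s.c ≤ t.c) (hl : s.l = t.l) (hr : s.r = t.r) : t.Good := by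
  intro k
  induction k generalizing s t with
  | zero =>
    have h0 : 0 ≤ s.excess := h 0
    change 0 ≤ t.excess
    rw [excess, hl, hr] at h0
    rw [excess]
    omega
  | succ k ih =>
    refine ih h.step ?_ ?_ hb ?_ ?_ <;> simp only [RunState.step, hl, hr] <;> omega

/-- The state of a run with period word `u` and empty repeated block. -/
def ofWord (u : List (Fin 3)) (l : Fin 4) (r : Fin 3) : RunState where
  a := 3 * u.count 0
  b := 3 * u.count 1
  c := 3 * u.count 2
  l := l
  r := r

theorem good_ofWord_pair : ∀ c d, Adjacent c d → ∀ l r, (ofWord [c, d] l r).Good := by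
  have h : ∀ c d, Adjacent c d → ∀ l r, (ofWord [c, d] l r).check 14 = true := by
    decide +kernel
  exact fun c d hcd l r => good_of_check (h c d hcd l r)

theorem good_ofWord_singleton : ∀ a c d, Adjacent a c → Adjacent c d →
    (ofWord [c] (a + c).castSucc (c + d)).Good := by
  have h : ∀ a c d, Adjacent a c → Adjacent c d →
      (ofWord [c] (a + c).castSucc (c + d)).check 14 = true := by
    decide +kernel
  exact fun a c d hac hcd => good_of_check (h a c d hac hcd)

theorem good_ofWord_start : (ofWord [0] 3 1).Good :=
  good_of_check (k := 14) (by decide +kernel)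

end RunState


theorem tern_image {I J m : ℕ} (h : Agree tern I J m) : ∃ L, m ≤ L ∧
    hpos (I + m) = hpos I + L ∧ hpos (J + m) = hpos J + L ∧
    Agree tern (hpos I) (hpos J) L := by
  have := h.image hm_ne_nil
  rwa [applyMorph_hm_tern] at this

theorem rote_image {I J m : ℕ} (h : Agree tern I J m) : ∃ L, m ≤ L ∧
    gpos (I + m) = gpos I + L ∧ gpos (J + m) = gpos J + L ∧
    Agree rote (gpos I) (gpos J) L :=
  h.image gm_ne_nil

theorem right_mismatch_image {p q : ℕ} (h : tern p ≠ tern q) : ∃ ε,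
    (ε = 0 ∧ tern p + tern q ≠ 2 ∨ ε = 1 ∧ tern p + tern q = 2 ∧ tern (hpos p) = 0 ∧
      tern (hpos q) = 0) ∧
    tern (hpos p + ε) ≠ tern (hpos q + ε) ∧
    tern (hpos p + ε) + tern (hpos q + ε) = ![2, 2, 0] (tern p + tern q) := by
  have key : ∀ q, tern q = 2 → tern (hpos q + 1) = 2 := by
    intro q hq
    have h1 : tern (q + 1) = 1 := (adjacent_tern q).2 hq
    rcases hm_block q with ⟨h2, -⟩ | ⟨h2, -⟩ | ⟨-, h2, -⟩
    · exact absurd (h2.symm.trans hq) (by decide)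
    · exact absurd (h2.symm.trans hq) (by decide)
    · rw [← h2]
      rcases hm_block (q + 1) with ⟨h3, -⟩ | ⟨-, -, h3, -⟩ | ⟨h3, -⟩
      · exact absurd (h3.symm.trans h1) (by decide)
      · exact h3
      · exact absurd (h3.symm.trans h1) (by decide)
  have kp := key p
  have kq := key q
  by_cases h2 : tern p + tern q = 2
  · refine ⟨1, ?_⟩
    rcases hm_block p with ⟨hp, -, hp0, hp1⟩ | ⟨hp, -, hp0, hp1⟩ | ⟨hp, -, hp0⟩ <;>
    rcases hm_block q with ⟨hq, -, hq0, hq1⟩ | ⟨hq, -, hq0, hq1⟩ | ⟨hq, -, hq0⟩ <;>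
    simp_all
  · refine ⟨0, ?_⟩
    rcases hm_block p with ⟨hp, -, hp0, hp1⟩ | ⟨hp, -, hp0, hp1⟩ | ⟨hp, -, hp0⟩ <;>
    rcases hm_block q with ⟨hq, -, hq0, hq1⟩ | ⟨hq, -, hq0, hq1⟩ | ⟨hq, -, hq0⟩ <;>
    simp_all

theorem leftType_succ (i j : ℕ) : leftType (i + 1) (j + 1) = (tern i + tern j).castSucc := rfl

theorem left_mismatch_preimage {i j : ℕ} (hij : i < j) (h0 : tern i = tern j)
    (h : i = 0 ∨ tern (i - 1) ≠ tern (j - 1)) : ∃ δ I J,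
    i + δ = hpos I ∧ j + δ = hpos J ∧ (I = 0 ∨ tern (I - 1) ≠ tern (J - 1)) ∧
    (δ = 0 ∧ leftType I J ≠ 1 ∨ δ = 1 ∧ leftType I J = 1 ∧ tern i = 1) ∧
    leftType i j = ![1, 2, 1, 3] (leftType I J) := by
  by_cases h1 : tern i = 1
  · obtain ⟨I, hI | ⟨rfl, -, hI, hI2⟩⟩ := exists_hpos_add i
    · exact absurd (hI ▸ h1) (tern_hpos_ne_one _)
    obtain ⟨J, hJ | ⟨rfl, -, hJ, hJ2⟩⟩ := exists_hpos_add j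
    · exact absurd (hJ ▸ h0.symm.trans h1) (tern_hpos_ne_one _)
    have h' : tern (hpos I) ≠ tern (hpos J) := by simpa using h
    refine ⟨1, I + 1, J + 1, hI.symm, hJ.symm, Or.inr ?_, Or.inr ⟨rfl, ?_, h1⟩, ?_⟩ <;>
    simp only [leftType_succ, Nat.add_sub_cancel] <;>
    rcases hm_block I with ⟨hp, -, hp0, hp1⟩ | ⟨hp, -, hp0, hp1⟩ | ⟨hp, -, hp0⟩ <;>
    rcases hm_block J with ⟨hq, -, hq0, hq1⟩ | ⟨hq, -, hq0, hq1⟩ | ⟨hq, -, hq0⟩ <;>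
    simp_all
  · obtain ⟨I, rfl⟩ := exists_hpos_eq h1
    obtain ⟨J, rfl⟩ := exists_hpos_eq (h0 ▸ h1)
    have hIJ : I < J := hpos_strictMono.lt_iff_lt.mp hij
    obtain ⟨J, rfl⟩ : ∃ J', J = J' + 1 := ⟨J - 1, by omega⟩
    refine ⟨0, I, J + 1, rfl, rfl, ?_⟩
    rcases I with _ | I
    · exact ⟨Or.inl rfl, Or.inl ⟨rfl, by simp [leftType]⟩, rfl⟩
    · have key : ∀ I, ∃ b, hpos (I + 1) = b + 1 ∧
          (tern I ≠ 2 ∧ tern b = 1 ∨ tern I = 2 ∧ tern b = 0) := by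
        intro I
        rcases hm_block I with ⟨h2, h3, -, h4⟩ | ⟨h2, h3, -, h4⟩ | ⟨h2, h3, h4⟩
        · exact ⟨_, h3, by rw [h2, h4]; decide⟩
        · exact ⟨_, h3, by rw [h2, h4]; decide⟩
        · exact ⟨_, h3, by rw [h2, h4]; decide⟩
      obtain ⟨b, hb, hb'⟩ := key I
      obtain ⟨c, hc, hc'⟩ := key J
      rw [hb, hc] at h ⊢
      simp only [leftType_succ, Nat.add_sub_cancel, Nat.succ_ne_zero, false_or] at h ⊢
      generalize tern I = x at *
      generalize tern J = y at *
      generalize tern b = z at *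
      generalize tern c = w at *
      refine ⟨?_, Or.inl ⟨trivial, ?_⟩, ?_⟩ <;> clear h1 h0 <;> revert x y z w <;> decide

theorem IsRun.exists_preimage {i j n : ℕ} (h : IsRun i j n) (hn : 1 ≤ n) :
    ∃ I J m, IsRun I J m ∧ J - I < j - i ∧ runState i j n = (runState I J m).step := by
  have h00 := h.agree 0 hn
  obtain ⟨δ, I, J, hI, hJ, hleft, hδ, hl⟩ := left_mismatch_preimage h.lt h00 h.left
  have hij := h.lt
  have hIJ : I < J := hpos_strictMono.lt_iff_lt.mp (by omega)
  obtain ⟨m, hm, hm'⟩ := exists_first_mismatch (exists_tern_mismatch hIJ)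
  obtain ⟨L, hmL, hLS, hLT, hLA⟩ := tern_image hm
  obtain ⟨ε, hε, hr, hr'⟩ := right_mismatch_image hm'
  have hnε : n = δ + L + ε := by
    refine h.agree.eq_of_mismatch h.right (fun t ht => ?_) ?_
    · rcases Nat.lt_or_ge t δ with h1 | h1
      · obtain rfl : t = 0 := by omega
        exact h00
      · obtain ⟨u, rfl⟩ := Nat.exists_eq_add_of_le h1
        rw [← add_assoc, ← add_assoc, hI, hJ]
        rcases Nat.lt_or_ge u L with h2 | h2
        · exact hLA u h2
        · obtain rfl : u = L := by omega
          rw [← hLS, ← hLT]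
          rcases hε with ⟨h3, -⟩ | ⟨-, -, h3, h4⟩
          · omega
          · rw [h3, h4]
    · rw [← add_assoc, ← add_assoc, ← add_assoc, ← add_assoc, hI, hJ, ← hLS, ← hLT]
      exact hr
  have hin : i + n = hpos (I + m) + ε := by rw [hLS, ← hI]; omega
  have hjn : j + n = hpos (J + m) + ε := by rw [hLT, ← hJ]; omega
  refine ⟨I, J, m, ⟨hIJ, hm, hm', hleft⟩, ?_, ?_⟩
  · rcases Nat.lt_or_ge (I + 1) J with h1 | h1
    · have := sub_lt_hpos_sub h1
      omega
    · obtain rfl : J = I + 1 := by omega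
      have : j ≠ i + 1 := fun hc => (adjacent_tern i).1 (hc ▸ h00)
      omega
  · have cI := letterCount_hpos I
    have cJ := letterCount_hpos J
    have cE := letterCount_hpos (I + m)
    have count_δ : ∀ c, ∀ k, tern k = tern i → letterCount c (k + δ) = letterCount c k +
        if leftType I J = 1 then (if c = 1 then 1 else 0) else 0 := by
      intro c k hk
      rcases hδ with ⟨rfl, h1⟩ | ⟨rfl, h1, h2⟩
      · simp [h1]
      · simp [h1, letterCount, hk, h2, eq_comm]
    have count_ε : ∀ c, letterCount c (i + n) = letterCount c (hpos (I + m)) +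
        if tern (I + m) + tern (J + m) = 2 then (if c = 0 then 1 else 0) else 0 := by
      intro c
      rw [hin]
      rcases hε with ⟨rfl, h1⟩ | ⟨rfl, h1, h2, -⟩
      · simp [h1]
      · simp [h1, letterCount, h2, eq_comm]
    have i0 := count_δ 0 i rfl
    have i1 := count_δ 1 i rfl
    have i2 := count_δ 2 i rfl
    have j0 := count_δ 0 j h00.symm
    have j1 := count_δ 1 j h00.symm
    have j2 := count_δ 2 j h00.symm
    have e0 := count_ε 0
    have e1 := count_ε 1
    have e2 := count_ε 2
    rw [hI] at i0 i1 i2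
    rw [hJ] at j0 j1 j2
    simp only [Fin.isValue, if_true, Fin.reduceEq, if_false, ite_self, add_zero,
      zero_ne_one, one_ne_zero] at i0 i1 i2 j0 j1 j2 e0 e1 e2
    ext1
    · simp only [runState, RunState.step]
      omega
    · simp only [runState, RunState.step]
      omega
    · simp only [runState, RunState.step]
      omega
    · exact hl
    · simp only [runState, RunState.step]
      rw [hin, hjn, hr']

theorem IsRun.good {i j n : ℕ} (h : IsRun i j n) : (runState i j n).Good := by
  obtain ⟨d, hd⟩ : ∃ d, d = j - i := ⟨_, rfl⟩
  induction d using Nat.strong_induction_on generalizing i j n with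
  | _ d ih =>
    rcases Nat.eq_zero_or_pos n with rfl | hn
    · have hij := h.lt
      have hadj := adjacent_tern i
      rcases Nat.lt_or_ge (i + 1) j with h1 | h1
      · have key : ∀ c, letterCount c i + ([tern i, tern (i + 1)].count c : ℤ) ≤
            letterCount c j := by
          intro c
          have := letterCount_mono c (show i + 2 ≤ j from h1)
          refine le_trans ?_ this
          simp only [letterCount, List.count_cons, List.count_nil, beq_iff_eq]
          split_ifs <;> simp <;> omega
        have k0 := key 0
        have k1 := key 1
        have k2 := key 2
        refine (RunState.good_ofWord_pair _ _ hadj (leftType i j)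
          (tern (i + 0) + tern (j + 0))).mono ?_ ?_ ?_ rfl rfl <;>
        · simp only [RunState.ofWord, runState, add_zero]
          omega
      · obtain rfl : j = i + 1 := by omega
        have hs : runState i (i + 1) 0 =
            RunState.ofWord [tern i] (leftType i (i + 1)) (tern i + tern (i + 1)) := by
          simp only [runState, RunState.ofWord, letterCount, List.count_cons, List.count_nil,
            beq_iff_eq, add_zero]
          ext1 <;> simp
        rw [hs]
        rcases i with _ | i
        · exact RunState.good_ofWord_start
        · exact RunState.good_ofWord_singleton _ _ _ (adjacent_tern i) hadj
    · obtain ⟨I, J, m, hrun, hlt, hs⟩ := h.exists_preimage hn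
      rw [hs]
      exact (ih (J - I) (by omega) hrun rfl).step


/-! ### Repetitions in the image under `gm` -/

theorem exists_gpos_of_one {b : ℕ} (h : rote b = 1) : ∃ i, gpos i < b ∧
    (tern i = 2 ∧ b = gpos i + 1 ∧ gpos (i + 1) = b + 1 ∨
      tern i = 0 ∧ b = gpos i + 1 ∧ gpos (i + 1) = b + 2 ∧ rote (b + 1) = 1 ∨
      tern i = 0 ∧ b = gpos i + 2 ∧ gpos (i + 1) = b + 1 ∧ rote (gpos i + 1) = 1) := by
  obtain ⟨i, t, ht, rfl⟩ := exists_blockPos_add (y := tern) gm_ne_nil b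
  have hs : gpos (i + 1) = gpos i + (gm (tern i)).length := rfl
  have h0 : t ≠ 0 := by
    rintro rfl
    exact absurd ((rote_gpos i).symm.trans h) (by decide)
  refine ⟨i, Nat.lt_add_of_pos_right (Nat.pos_of_ne_zero h0), ?_⟩
  rcases gm_block i with ⟨h1, h2, -, h3, h4⟩ | ⟨h1, h2, -⟩ | ⟨h1, h2, -, h3⟩
  · obtain rfl | rfl : t = 1 ∨ t = 2 := by omega
    · exact Or.inr (Or.inl ⟨h1, rfl, h2, h4⟩)
    · exact Or.inr (Or.inr ⟨h1, rfl, h2, h3⟩)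
  · omega
  · obtain rfl : t = 1 := by omega
    exact Or.inl ⟨h1, rfl, h2⟩

theorem exists_rote_eq_zero (b : ℕ) : ∃ δ ≤ 2, rote (b + δ) = 0 := by
  by_cases h : rote b = 0
  · exact ⟨0, by omega, h⟩
  · obtain ⟨i, -, ⟨-, -, h2⟩ | ⟨-, -, h2, -⟩ | ⟨-, -, h2, -⟩⟩ :=
      exists_gpos_of_one (Fin.eq_one_of_ne_zero _ h)
    · exact ⟨1, by omega, h2 ▸ rote_gpos _⟩
    · exact ⟨2, by omega, h2 ▸ rote_gpos _⟩
    · exact ⟨1, by omega, h2 ▸ rote_gpos _⟩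

theorem exists_rote_mismatch {i j : ℕ} (h : i < j) : ∃ t, rote (i + t) ≠ rote (j + t) := by
  by_contra! hc
  obtain ⟨δ, -, hδ⟩ := exists_rote_eq_zero i
  obtain ⟨I, hI⟩ := exists_gpos_eq hδ
  obtain ⟨J, hJ⟩ := exists_gpos_eq ((hc δ).symm.trans hδ)
  have hIJ : I < J := gpos_strictMono.lt_iff_lt.mp (by omega)
  obtain ⟨m, hm⟩ := exists_tern_mismatch hIJ
  obtain ⟨L, hL⟩ := Nat.exists_eq_add_of_le
    (gpos_strictMono.monotone (show I ≤ I + m + 1 by omega))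
  have hag : ∀ t, rote (gpos I + t) = rote (gpos J + t) := fun t => by
    rw [← hI, ← hJ, add_assoc, add_assoc, hc]
  obtain ⟨F, hF⟩ := exists_gpos_eq (b := gpos J + L) (by rw [← hag, ← hL]; exact rote_gpos _)
  obtain ⟨m', h1, -, h3⟩ := rote_preimage (fun t _ => hag t) hL hF.symm
  exact hm (h3 m (by omega))

theorem excess_runState (i j n : ℕ) : (runState i j n).excess =
    3 * ((gpos j : ℤ) - gpos i) - 2 * ((gpos (i + n) : ℤ) - gpos i) -
      2 * ((if leftType i j = 2 then 1 else 0) + 1 +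
        if tern (i + n) + tern (j + n) = 2 then 1 else 0) := by
  have hl : (runState i j n).l = leftType i j := rfl
  have hr : (runState i j n).r = tern (i + n) + tern (j + n) := rfl
  rw [RunState.excess, hl, hr, gpos_eq, gpos_eq, gpos_eq]
  simp only [runState]
  ring

theorem right_mismatch_image_gm {p q : ℕ} (h : tern p ≠ tern q) : ∃ ε,
    ε = (if tern p + tern q = 2 then 1 else 0) ∧
    (∀ t ≤ ε, rote (gpos p + t) = rote (gpos q + t)) ∧
    rote (gpos p + 1 + ε) ≠ rote (gpos q + 1 + ε) := by
  refine ⟨_, rfl, ?_⟩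
  have hp := rote_gpos (p + 1)
  have hq := rote_gpos (q + 1)
  rcases gm_block p with ⟨p0, p1, p2, p3, p4⟩ | ⟨p0, p1, p2⟩ | ⟨p0, p1, p2, p3⟩ <;>
  rcases gm_block q with ⟨q0, q1, q2, q3, q4⟩ | ⟨q0, q1, q2⟩ | ⟨q0, q1, q2, q3⟩ <;>
  rw [p0, q0] at h ⊢ <;> rw [p1] at hp <;> rw [q1] at hq <;>
  first
  | exact absurd rfl h
  | simp [*, Nat.le_one_iff_eq_zero_or_eq_one, add_assoc]

theorem left_mismatch_preimage_gm {i j n a I J : ℕ} (hij : i < j) (h : Agree rote i j n)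
    (hl : i = 0 ∨ rote (i - 1) ≠ rote (j - 1)) (han : a < n)
    (ha : ∀ t < a, rote (i + t) ≠ 0) (hI : i + a = gpos I) (hJ : j + a = gpos J) :
    (I = 0 ∨ tern (I - 1) ≠ tern (J - 1)) ∧ a ≤ if leftType I J = 2 then 1 else 0 := by
  have hIJ : I < J := gpos_strictMono.lt_iff_lt.mp (by omega)
  obtain ⟨J, rfl⟩ : ∃ J', J = J' + 1 := ⟨J - 1, by omega⟩
  rcases I with _ | I
  · have h0 : gpos 0 = 0 := rfl
    exact ⟨Or.inl rfl, by omega⟩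
  · rw [leftType_succ]
    simp only [Nat.add_sub_cancel, Nat.succ_ne_zero, false_or]
    have hne : tern I ≠ tern J := by
      intro hc
      obtain ⟨L, -, hLI, hLJ, hL⟩ := rote_image (I := I) (J := J) (m := 1) fun t ht => by
        obtain rfl : t = 0 := by omega
        exact hc
      rcases Nat.lt_or_ge a L with h1 | h1
      · have := hL (L - a - 1) (by omega)
        rw [show gpos I + (L - a - 1) = i - 1 by omega,
          show gpos J + (L - a - 1) = j - 1 by omega] at this
        rcases hl with hl | hl
        · omega
        · exact hl this
      · have hp := gpos_strictMono (show I < I + 1 by omega)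
        refine ha (a - L) (by omega) ?_
        rw [show i + (a - L) = gpos I by omega, rote_gpos]
    refine ⟨hne, ?_⟩
    rcases Nat.eq_zero_or_pos a with rfl | hpos
    · exact Nat.zero_le _
    · have e1 : rote (gpos I) = 0 := rote_gpos I
      have e2 : rote (gpos J) = 0 := rote_gpos J
      have z1 := ha (a - 1) (by omega)
      have z2 := h (a - 1) (by omega) ▸ z1
      have y1 := ha (a - 2)
      have y2 := h (a - 2) (by omega)
      rcases gm_block I with ⟨p0, p1, -⟩ | ⟨p0, p1, -⟩ | ⟨p0, p1, -⟩ <;>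
      rcases gm_block J with ⟨q0, q1, -⟩ | ⟨q0, q1, -⟩ | ⟨q0, q1, -⟩ <;>
      rw [p0, q0] at hne ⊢ <;>
      first
      | exact absurd rfl hne
      | exact absurd (by rwa [show i + (a - 1) = gpos I by omega]) z1
      | exact absurd (by rwa [show j + (a - 1) = gpos J by omega]) z2
      | by_contra hc
        have hc : 2 ≤ a := by
          simp at hc
          omega
        have y1 := y1 (by omega)
        first
        | exact absurd (by rwa [show i + (a - 2) = gpos I by omega]) y1
        | exact absurd (by rwa [y2, show j + (a - 2) = gpos J by omega]) y1

theorem two_mul_le_of_maximal {i j n : ℕ} (hij : i < j) (h : Agree rote i j n)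
    (hr : rote (i + n) ≠ rote (j + n)) (hl : i = 0 ∨ rote (i - 1) ≠ rote (j - 1)) :
    2 * n ≤ 3 * (j - i) := by
  obtain ⟨δ, hδ, hδ0⟩ := exists_rote_eq_zero i
  by_cases hz : ∃ a, rote (i + a) = 0 ∧ a < n
  · classical
    obtain ⟨hfa, han⟩ := Nat.find_spec hz
    have hfmin : ∀ t < Nat.find hz, rote (i + t) ≠ 0 := fun t ht h0 =>
      Nat.find_min hz ht ⟨h0, by omega⟩
    generalize Nat.find hz = a at *
    obtain ⟨I, hI⟩ := exists_gpos_eq hfa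
    obtain ⟨J, hJ⟩ := exists_gpos_eq ((h a han).symm.trans hfa)
    have hIJ : I < J := gpos_strictMono.lt_iff_lt.mp (by omega)
    obtain ⟨hleft, hal⟩ := left_mismatch_preimage_gm hij h hl han hfmin hI hJ
    obtain ⟨m, hm, hm'⟩ := exists_first_mismatch (exists_tern_mismatch hIJ)
    obtain ⟨L, hmL, hLS, hLT, hLA⟩ := rote_image hm
    obtain ⟨ε, hε, hεA, hεr⟩ := right_mismatch_image_gm hm'
    have hnε : n = a + L + 1 + ε := by
      refine h.eq_of_mismatch hr (fun t ht => ?_) ?_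
      · rcases Nat.lt_or_ge t a with h1 | h1
        · exact h t (by omega)
        · obtain ⟨u, rfl⟩ := Nat.exists_eq_add_of_le h1
          rw [← add_assoc, ← add_assoc, hI, hJ]
          rcases Nat.lt_or_ge u L with h2 | h2
          · exact hLA u h2
          · obtain ⟨v, rfl⟩ := Nat.exists_eq_add_of_le h2
            rw [← add_assoc, ← add_assoc, ← hLS, ← hLT]
            exact hεA v (by omega)
      · simp only [← add_assoc]
        rw [hI, hJ, ← hLS, ← hLT]
        exact hεr
    have hgood := (IsRun.good ⟨hIJ, hm, hm', hleft⟩) 0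
    rw [Function.iterate_zero, id_eq, excess_runState] at hgood
    split_ifs at hgood hε hal <;> omega
  · push Not at hz
    have h1 := hz δ hδ0
    by_cases hc : 2 ≤ n ∧ j = i + 1
    · obtain ⟨hn, rfl⟩ := hc
      have h0 := h (δ - 1) (by omega)
      have hδ1 : δ ≠ 0 := by rintro rfl; omega
      rw [show i + 1 + (δ - 1) = i + δ by omega, hδ0] at h0
      have := hz _ h0
      omega
    · omega

theorem two_mul_le_of_agree (i p n : ℕ) (hp : 1 ≤ p) (h : Agree rote i (i + p) n) :
    2 * n ≤ 3 * p := by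
  induction i generalizing n with
  | zero =>
    obtain ⟨m, hm, hm'⟩ := exists_first_mismatch (exists_rote_mismatch (show 0 < 0 + p by omega))
    have := two_mul_le_of_maximal (by omega) hm hm' (Or.inl rfl)
    have hnm : n ≤ m := not_lt.mp fun hc => hm' (h m hc)
    omega
  | succ i ih =>
    by_cases hl : rote i = rote (i + p)
    · refine le_trans (by omega) (ih (n + 1) fun t ht => ?_)
      rcases t with _ | t
      · exact hl
      · have := h t (by omega)
        rwa [show i + 1 + t = i + (t + 1) by ring,
          show i + 1 + p + t = i + p + (t + 1) by ring] at this
    · obtain ⟨m, hm, hm'⟩ :=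
        exists_first_mismatch (exists_rote_mismatch (show i + 1 < i + 1 + p by omega))
      have := two_mul_le_of_maximal (by omega) hm hm' (Or.inr (by
        rwa [show i + 1 + p - 1 = i + p by omega]))
      have hnm : n ≤ m := not_lt.mp fun hc => hm' (h m hc)
      omega


/-! ### Right special factors -/

theorem factorAt_succ {A : Type*} (x : ℕ → A) (i n : ℕ) :
    FactorAt x i (n + 1) = FactorAt x i n ++ [x (i + n)] := by
  simp [FactorAt, List.range_succ]

/-- The factors of length `n` of `x` that can be followed by the letter `a`. -/
def followedBy {A : Type*} (x : ℕ → A) (n : ℕ) (a : A) : Set (List A) :=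
  {w | ∃ i, w = FactorAt x i n ∧ x (i + n) = a}

theorem complexity_succ (x : ℕ → Fin 2) (n : ℕ) :
    complexity x (n + 1) = complexity x n + (followedBy x n 0 ∩ followedBy x n 1).ncard := by
  have hunion : followedBy x n 0 ∪ followedBy x n 1 = factorSet x n := by
    rw [factorSet_eq_range]
    ext w
    constructor
    · rintro (⟨i, rfl, -⟩ | ⟨i, rfl, -⟩) <;> exact ⟨i, rfl⟩
    · rintro ⟨i, rfl⟩
      by_cases h : x (i + n) = 0
      · exact Or.inl ⟨i, rfl, h⟩
      · exact Or.inr ⟨i, rfl, Fin.eq_one_of_ne_zero _ h⟩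
  have hsucc : factorSet x (n + 1) =
      (· ++ [0]) '' followedBy x n 0 ∪ (· ++ [1]) '' followedBy x n 1 := by
    rw [factorSet_eq_range]
    ext w
    constructor
    · rintro ⟨i, rfl⟩
      simp only [factorAt_succ]
      by_cases h : x (i + n) = 0
      · exact Or.inl ⟨_, ⟨i, rfl, h⟩, by simp [h]⟩
      · have h1 := Fin.eq_one_of_ne_zero _ h
        exact Or.inr ⟨_, ⟨i, rfl, h1⟩, by simp [h1]⟩
    · rintro (⟨_, ⟨i, rfl, h⟩, rfl⟩ | ⟨_, ⟨i, rfl, h⟩, rfl⟩) <;>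
      exact ⟨i, by simp [factorAt_succ, h]⟩
  have hfin := factorSet_finite x n
  have hfin0 : (followedBy x n 0).Finite := hfin.subset (hunion ▸ Set.subset_union_left)
  have hfin1 : (followedBy x n 1).Finite := hfin.subset (hunion ▸ Set.subset_union_right)
  have hdisj : Disjoint ((· ++ [0]) '' followedBy x n 0) ((· ++ [1]) '' followedBy x n 1) := by
    rw [Set.disjoint_left]
    rintro _ ⟨u, -, rfl⟩ ⟨v, -, h⟩
    simpa using (List.append_inj' h rfl).2
  change (factorSet x (n + 1)).ncard = (factorSet x n).ncard + _
  rw [hsucc, Set.ncard_union_eq hdisj (hfin0.image _) (hfin1.image _),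
    Set.ncard_image_of_injective _ (List.append_left_injective _),
    Set.ncard_image_of_injective _ (List.append_left_injective _), ← hunion,
    Set.ncard_union_add_ncard_inter _ _ hfin0 hfin1]

theorem exists_desubst_left_gm {s : Fin 4 → ℕ} (h0 : rote (s 0) = 0) (h1 : rote (s 1) = 0)
    (h2 : rote (s 2) = 1) (h3 : rote (s 3) = 1) (h : ∀ k, rote (s 0 + 1) = rote (s k + 1))
    (h' : rote (s 0 + 1) = 1 → ∀ k, rote (s k + 2) = 0) :
    ∃ (T : Fin 4 → ℕ) (δ : ℕ), δ ≤ 1 ∧ (∀ k, gpos (T k + 1) = s k + 1 + δ) ∧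
      (LeftSep fun k => tern (T k)) ∧ (δ = 1 → rote (s 0 + 1) = 1) := by
  by_cases hw : rote (s 0 + 1) = 0
  · have key : ∀ k, ∃ T, gpos (T + 1) = s k + 1 ∧ (rote (s k) = 0 ↔ tern T = 1) := by
      intro k
      obtain ⟨U, hU⟩ := exists_gpos_eq ((h k).symm.trans hw)
      cases U with
      | zero => exact absurd hU (by rw [show gpos 0 = 0 from rfl]; omega)
      | succ T =>
        refine ⟨T, hU.symm, ?_⟩
        rcases gm_block T with ⟨h2, h3, -, -, h4⟩ | ⟨h2, h3, h4⟩ | ⟨h2, h3, -, h4⟩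
        · rw [show s k = gpos T + 2 by omega, h2, h4]; decide
        · rw [show s k = gpos T by omega, h2, h4]; decide
        · rw [show s k = gpos T + 1 by omega, h2, h4]; decide
    choose T hT hT' using key
    refine ⟨T, 0, Nat.zero_le _, hT, ?_, fun h => absurd h (by decide)⟩
    have t0 := hT' 0
    have t1 := hT' 1
    have t2 := hT' 2
    have t3 := hT' 3
    unfold LeftSep
    grind
  · have hw := Fin.eq_one_of_ne_zero _ hw
    have key : ∀ k, ∃ T, gpos (T + 1) = s k + 2 ∧
        (rote (s k) = 0 ∧ tern T = 2 ∨ rote (s k) = 1 ∧ tern T = 0) := by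
      intro k
      obtain ⟨T, -, ⟨t0, t1, t2⟩ | ⟨-, -, -, t3⟩ | ⟨t0, t1, t2, t3⟩⟩ :=
        exists_gpos_of_one ((h k).symm.trans hw)
      · refine ⟨T, t2, Or.inl ⟨?_, t0⟩⟩
        rw [show s k = gpos T by omega, rote_gpos]
      · exact absurd ((h' hw k).symm.trans t3) (by decide)
      · refine ⟨T, t2, Or.inr ⟨?_, t0⟩⟩
        rw [show s k = gpos T + 1 by omega, t3]
    choose T hT hT' using key
    refine ⟨T, 1, le_rfl, hT, ?_, fun _ => hw⟩
    have t0 := hT' 0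
    have t1 := hT' 1
    have t2 := hT' 2
    have t3 := hT' 3
    unfold LeftSep
    grind

theorem rote_add_two_eq_zero {b : ℕ} (h0 : rote b = 1) (h1 : rote (b + 1) = 1) :
    rote (b + 2) = 0 := by
  obtain ⟨i, -, ⟨-, -, h2⟩ | ⟨-, -, h2, -⟩ | ⟨-, -, h2, -⟩⟩ := exists_gpos_of_one h0
  · exact absurd (h1.symm.trans (h2 ▸ rote_gpos _)) (by decide)
  · exact h2 ▸ rote_gpos _
  · exact absurd (h1.symm.trans (h2 ▸ rote_gpos _)) (by decide)

theorem exists_desubst_right_gm {n : ℕ} (hn : 1 ≤ n) {s : Fin 4 → ℕ} (hl : rote (s 3) = 1)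
    (h : ∀ k, Agree rote (s 0 + 1) (s k + 1) n)
    (h0 : rote (s 0 + 1 + n) = 0) (h1 : rote (s 1 + 1 + n) = 1)
    (h2 : rote (s 2 + 1 + n) = 0) (h3 : rote (s 3 + 1 + n) = 1) :
    ∃ (E : Fin 4 → ℕ) (q : ℕ), q ≤ n ∧ (∀ k, gpos (E k) = s k + 1 + q) ∧
      (RightSepB (fun k => tern (E k)) ∨ RightSepA (fun k => tern (E k))) := by
  obtain ⟨r, rfl⟩ := Nat.exists_eq_add_of_le' hn
  simp only [← add_assoc] at h0 h1 h2 h3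
  by_cases hw : rote (s 0 + 1 + r) = 0
  · have key : ∀ k, ∃ E, gpos E = s k + 1 + r ∧ (rote (s k + 1 + r + 1) = 0 ↔ tern E = 1) := by
      intro k
      have hk := (h k r (by omega)).symm.trans hw
      obtain ⟨E, hE⟩ := exists_gpos_eq hk
      refine ⟨E, hE.symm, ?_⟩
      rw [hE]
      rcases gm_block E with ⟨e0, -, -, e1, -⟩ | ⟨e0, e1, -⟩ | ⟨e0, -, -, e1⟩
      · rw [e0, e1]; decide
      · rw [← e1, rote_gpos, e0]; decide
      · rw [e0, e1]; decide
    choose E hE hE' using key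
    refine ⟨E, r, by omega, hE, Or.inl ?_⟩
    have e0 := hE' 0
    have e1 := hE' 1
    have e2 := hE' 2
    have e3 := hE' 3
    unfold RightSepB
    grind
  · have hw := Fin.eq_one_of_ne_zero _ hw
    have hone : ∀ k, rote (s k + 1 + r) = 1 := fun k => (h k r (by omega)).symm.trans hw
    cases r with
    | zero => exact absurd (h3.symm.trans (rote_add_two_eq_zero hl (hone 3))) (by decide)
    | succ r =>
      have hzero : ∀ k, rote (s k + 1 + r) = 0 := by
        have h10 : rote (s 1 + 1 + r) = 0 := by
          by_contra hc
          exact absurd (h1.symm.trans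
            (rote_add_two_eq_zero (Fin.eq_one_of_ne_zero _ hc) (hone 1))) (by decide)
        exact fun k => by rw [← h k r (by omega), h 1 r (by omega), h10]
      have key : ∀ k, ∃ E, gpos E = s k + 1 + r ∧
          (rote (s k + 1 + (r + 1) + 1) = 0 ∧ tern E = 2 ∨
            rote (s k + 1 + (r + 1) + 1) = 1 ∧ tern E = 0) := by
        intro k
        obtain ⟨E, -, ⟨t0, t1, t2⟩ | ⟨t0, t1, -, t3⟩ | ⟨-, t1, -, t3⟩⟩ :=
          exists_gpos_of_one (hone k)
        · exact ⟨E, by omega, Or.inl ⟨t2 ▸ rote_gpos _, t0⟩⟩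
        · exact ⟨E, by omega, Or.inr ⟨t3, t0⟩⟩
        · rw [show gpos E + 1 = s k + 1 + r by omega, hzero] at t3
          exact absurd t3 (by decide)
      choose E hE hE' using key
      refine ⟨E, r, by omega, hE, Or.inr ?_⟩
      have e0 := hE' 0
      have e1 := hE' 1
      have e2 := hE' 2
      have e3 := hE' 3
      unfold RightSepA
      grind

theorem not_separated_rote {n : ℕ} (hn : 1 ≤ n) {s : Fin 4 → ℕ}
    (hl0 : rote (s 0) = 0) (hl1 : rote (s 1) = 0) (hl2 : rote (s 2) = 1) (hl3 : rote (s 3) = 1)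
    (h : ∀ k, Agree rote (s 0 + 1) (s k + 1) n)
    (h0 : rote (s 0 + 1 + n) = 0) (h1 : rote (s 1 + 1 + n) = 1)
    (h2 : rote (s 2 + 1 + n) = 0) (h3 : rote (s 3 + 1 + n) = 1) : False := by
  have hsnd : rote (s 0 + 1) = 1 → ∀ k, rote (s k + 2) = 0 := by
    intro hw k
    have hone : ∀ k, rote (s k + 1) = 1 := fun k => (h k 0 hn).symm.trans hw
    rcases Nat.lt_or_ge 1 n with hn1 | hn1
    · have e2 := h 2 1 hn1
      have ek := h k 1 hn1
      rw [add_assoc, add_assoc] at e2 ek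
      rw [← ek, e2]
      exact rote_add_two_eq_zero hl2 (hone 2)
    · obtain rfl : n = 1 := by omega
      exact absurd (h3.symm.trans (rote_add_two_eq_zero hl3 (hone 3))) (by decide)
  obtain ⟨T, δ, hδ, hT, hTl, hδ1⟩ :=
    exists_desubst_left_gm hl0 hl1 hl2 hl3 (fun k => h k 0 hn) hsnd
  obtain ⟨E, q, hqn, hE, hr⟩ := exists_desubst_right_gm hn hl3 h h0 h1 h2 h3
  have hδq : δ ≤ q := by
    by_contra hc
    have e1 := hδ1 (by omega)
    have e2 := rote_gpos (E 0)
    rw [hE, show q = 0 by omega, add_zero, e1] at e2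
    exact absurd e2 (by decide)
  obtain ⟨L, rfl⟩ := Nat.exists_eq_add_of_le hδq
  have key : ∀ k, ∃ m, E 0 = T 0 + 1 + m ∧ E k = T k + 1 + m ∧
      Agree tern (T 0 + 1) (T k + 1) m := by
    intro k
    refine rote_preimage (L := L) (fun t ht => ?_) (by rw [hE, hT, add_assoc _ δ L])
      (by rw [hE, hT, add_assoc _ δ L])
    rw [hT, hT, add_assoc, add_assoc _ δ t]
    exact h k (δ + t) (by omega)
  obtain ⟨m, hm0, -, -⟩ := key 0
  have hm : ∀ k, E k = T k + 1 + m ∧ Agree tern (T 0 + 1) (T k + 1) m := by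
    intro k
    obtain ⟨m', h1, h2, h3⟩ := key k
    obtain rfl : m = m' := by omega
    exact ⟨h2, h3⟩
  simp only [(hm _).1] at hr
  have := not_separated_tern m T hTl fun k => (hm k).2
  exact hr.elim this.1 this.2

/-- The blocks of length `n` at `i` and `j` agree and are followed by `0` and `1`
respectively. -/
def IsSpecialPair (i j n : ℕ) : Prop :=
  Agree rote i j n ∧ rote (i + n) = 0 ∧ rote (j + n) = 1

theorem IsSpecialPair.agree_of_last {i i' j j' n : ℕ} (h : IsSpecialPair i i' (n + 1))
    (h' : IsSpecialPair j j' (n + 1)) (hlast : rote (i + n) = rote (j + n)) :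
    Agree rote i j (n + 1) := by
  have key : ∀ t ≤ n, rote (i + (n - t)) = rote (j + (n - t)) := by
    intro t
    induction t using Nat.strong_induction_on with
    | _ t ih =>
      intro ht
      rcases Nat.eq_zero_or_pos t with rfl | ht0
      · exact hlast
      by_contra hc
      have hstep : ∀ {i i' j j' : ℕ}, IsSpecialPair i i' (n + 1) → IsSpecialPair j j' (n + 1) →
          (∀ u < t, rote (i + (n - u)) = rote (j + (n - u))) →
          rote (i + (n - t)) = 0 → rote (j + (n - t)) = 1 → False := by
        rintro i i' j j' ⟨h1, h2, h3⟩ ⟨h1', h2', h3'⟩ hu hi hj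
        have e1 := h1 (n - t) (by omega)
        have e2 := h1' (n - t) (by omega)
        have hag : ∀ v < t, rote (i + (n - t) + 1 + v) = rote (j + (n - t) + 1 + v) := by
          intro v hv
          have := hu (t - 1 - v) (by omega)
          rwa [show i + (n - (t - 1 - v)) = i + (n - t) + 1 + v by omega,
            show j + (n - (t - 1 - v)) = j + (n - t) + 1 + v by omega] at this
        have hag1 : ∀ v < t, rote (i + (n - t) + 1 + v) = rote (i' + (n - t) + 1 + v) := by
          intro v hv
          have := h1 (n - t + 1 + v) (by omega)
          simpa only [add_assoc] using this
        have hag2 : ∀ v < t, rote (j + (n - t) + 1 + v) = rote (j' + (n - t) + 1 + v) := by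
          intro v hv
          have := h1' (n - t + 1 + v) (by omega)
          simpa only [add_assoc] using this
        have hend : ∀ i, i + (n - t) + 1 + t = i + (n + 1) := by omega
        refine not_separated_rote (n := t) ht0
          (s := ![i + (n - t), i' + (n - t), j + (n - t), j' + (n - t)])
          hi (e1 ▸ hi) hj (e2 ▸ hj) ?_ ?_ ?_ ?_ ?_
        · intro k v hv
          fin_cases k
          · rfl
          · exact hag1 v hv
          · exact hag v hv
          · exact (hag v hv).trans (hag2 v hv)
        · exact (hend i).symm ▸ h2
        · exact (hend i').symm ▸ h3
        · exact (hend j).symm ▸ h2'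
        · exact (hend j').symm ▸ h3'
      by_cases h0 : rote (i + (n - t)) = 0
      · exact hstep h h' (fun u hu => ih u hu (by omega)) h0
          (Fin.eq_one_of_ne_zero _ fun h1 => hc (h0.trans h1.symm))
      · have h1 := Fin.eq_one_of_ne_zero _ h0
        refine hstep h' h (fun u hu => (ih u hu (by omega)).symm) ?_ h1
        by_contra h2
        exact hc (h1.trans (Fin.eq_one_of_ne_zero _ h2).symm)
  intro t ht
  have := key (n - t) (by omega)
  rwa [show n - (n - t) = t by omega] at this

theorem Agree.shift {A : Type*} {x : ℕ → A} {i j m k : ℕ} (h : Agree x i j (k + m)) :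
    Agree x (i + k) (j + k) m := fun t ht => by
  rw [add_assoc, add_assoc]
  exact h (k + t) (by omega)

theorem exists_right_special_tern (m : ℕ) :
    (∃ i j, Agree tern i j m ∧ tern (i + m) = 0 ∧ tern (j + m) = 2) ∧
    (∃ i j, Agree tern i j m ∧ tern (i + m) = 1 ∧ tern (j + m) ≠ 1) := by
  have hAB : ∀ m, (∃ i j, Agree tern i j m ∧ tern (i + m) = 0 ∧ tern (j + m) = 2) →
      ∃ i j, Agree tern i j (m + 1) ∧ tern (i + (m + 1)) = 1 ∧ tern (j + (m + 1)) ≠ 1 := by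
    rintro m ⟨i, j, h, hi, hj⟩
    obtain ⟨L, hmL, hLi, hLj, hL⟩ := tern_image h
    obtain ⟨k, rfl⟩ := Nat.exists_eq_add_of_le' hmL
    rcases hm_block (i + m) with ⟨-, -, i1, i2⟩ | ⟨hc, -⟩ | ⟨hc, -⟩
    · rcases hm_block (j + m) with ⟨hc, -⟩ | ⟨hc, -⟩ | ⟨-, j1, j2⟩
      · exact absurd (hc.symm.trans hj) (by decide)
      · exact absurd (hc.symm.trans hj) (by decide)
      · refine ⟨hpos i + k, hpos j + k, Agree.shift fun t ht => ?_, ?_, ?_⟩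
        · rcases Nat.lt_or_ge t (k + m) with h1 | h1
          · exact hL t h1
          · obtain rfl : t = k + m := by omega
            rw [← hLi, ← hLj, i1, j2]
        · rw [← i2, hLi]
          congr 1
          ring
        · rw [show hpos j + k + (m + 1) = hpos (j + m + 1) by rw [j1, hLj]; ring]
          exact tern_hpos_ne_one _
    · exact absurd (hc.symm.trans hi) (by decide)
    · exact absurd (hc.symm.trans hi) (by decide)
  have hBA : ∀ m, (∃ i j, Agree tern i j m ∧ tern (i + m) = 1 ∧ tern (j + m) ≠ 1) →
      ∃ i j, Agree tern i j m ∧ tern (i + m) = 0 ∧ tern (j + m) = 2 := by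
    rintro m ⟨i, j, h, hi, hj⟩
    obtain ⟨L, hmL, hLi, hLj, hL⟩ := tern_image h
    obtain ⟨k, rfl⟩ := Nat.exists_eq_add_of_le' hmL
    have i1 : tern (hpos (i + m)) = 2 := by
      rcases hm_block (i + m) with ⟨hc, -⟩ | ⟨-, -, h, -⟩ | ⟨hc, -⟩
      · exact absurd (hc.symm.trans hi) (by decide)
      · exact h
      · exact absurd (hc.symm.trans hi) (by decide)
    have j1 : tern (hpos (j + m)) = 0 := by
      rcases hm_block (j + m) with ⟨-, -, h, -⟩ | ⟨hc, -⟩ | ⟨-, -, h⟩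
      · exact h
      · exact absurd hc hj
      · exact h
    refine ⟨hpos j + k, hpos i + k, Agree.shift fun t ht => (hL t ht).symm, ?_, ?_⟩
    · rw [add_assoc, ← hLj, j1]
    · rw [add_assoc, ← hLi, i1]
  induction m with
  | zero =>
    exact ⟨⟨0, 2, fun t ht => by omega, rfl, rfl⟩, ⟨1, 0, fun t ht => by omega, rfl, by decide⟩⟩
  | succ m ih => exact ⟨hBA _ (hAB _ ih.1), hAB _ ih.1⟩

theorem exists_isSpecialPair (n : ℕ) (c : Fin 2) :
    ∃ i j, IsSpecialPair i j (n + 1) ∧ rote (i + n) = c := by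
  obtain ⟨⟨i, j, h, hi, hj⟩, ⟨i', j', h', hi', hj'⟩⟩ := exists_right_special_tern n
  by_cases hc : c = 0
  · subst hc
    obtain ⟨L, hmL, hLi, hLj, hL⟩ := rote_image h'
    obtain ⟨k, rfl⟩ := Nat.exists_eq_add_of_le' hmL
    have i1 : rote (gpos (i' + n) + 1) = 0 := by
      rcases gm_block (i' + n) with ⟨hc, -⟩ | ⟨-, h, -⟩ | ⟨hc, -⟩
      · exact absurd (hc.symm.trans hi') (by decide)
      · rw [← h, rote_gpos]
      · exact absurd (hc.symm.trans hi') (by decide)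
    have j1 : rote (gpos (j' + n) + 1) = 1 := by
      rcases gm_block (j' + n) with ⟨-, -, -, h, -⟩ | ⟨hc, -⟩ | ⟨-, -, -, h⟩
      · exact h
      · exact absurd hc hj'
      · exact h
    have i0 := rote_gpos (i' + n)
    have j0 := rote_gpos (j' + n)
    rw [hLi] at i0 i1
    rw [hLj] at j0 j1
    refine ⟨gpos i' + k, gpos j' + k, ⟨Agree.shift fun t ht => ?_, ?_, ?_⟩, ?_⟩
    · rcases Nat.lt_or_ge t (k + n) with h1 | h1
      · exact hL t h1
      · obtain rfl : t = k + n := by omega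
        rw [i0, j0]
    · rwa [← add_assoc, add_assoc _ k n]
    · rwa [← add_assoc, add_assoc _ k n]
    · rwa [add_assoc]
  · have hc := Fin.eq_one_of_ne_zero _ hc
    subst hc
    obtain ⟨L, hmL, hLi, hLj, hL⟩ := rote_image h
    obtain ⟨k, rfl⟩ := Nat.exists_eq_add_of_le' hmL
    rcases gm_block (i + n) with ⟨-, -, i0, i1, i2⟩ | ⟨hc, -⟩ | ⟨hc, -⟩
    · rcases gm_block (j + n) with ⟨hc, -⟩ | ⟨hc, -⟩ | ⟨-, j2, j0, j1⟩
      · exact absurd (hc.symm.trans hj) (by decide)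
      · exact absurd (hc.symm.trans hj) (by decide)
      · have j2 : rote (gpos (j + n) + 2) = 0 := j2 ▸ rote_gpos _
        rw [hLi] at i0 i1 i2
        rw [hLj] at j0 j1 j2
        refine ⟨gpos j + (k + 1), gpos i + (k + 1), ⟨Agree.shift fun t ht => ?_, ?_, ?_⟩, ?_⟩
        · rcases Nat.lt_or_ge t (k + n) with h1 | h1
          · exact (hL t h1).symm
          · obtain rfl | rfl : t = k + n ∨ t = k + n + 1 := by omega
            · rw [i0, j0]
            · exact j1.trans i1.symm
        · rwa [show gpos j + (k + 1) + (n + 1) = gpos j + (k + n) + 2 by ring]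
        · rwa [show gpos i + (k + 1) + (n + 1) = gpos i + (k + n) + 2 by ring]
        · rwa [show gpos j + (k + 1) + n = gpos j + (k + n) + 1 by ring]
    · exact absurd (hc.symm.trans hi) (by decide)
    · exact absurd (hc.symm.trans hi) (by decide)

theorem ncard_right_special_rote (n : ℕ) :
    (followedBy rote (n + 1) 0 ∩ followedBy rote (n + 1) 1).ncard = 2 := by
  obtain ⟨i, i', h, hi⟩ := exists_isSpecialPair n 0
  obtain ⟨j, j', h', hj⟩ := exists_isSpecialPair n 1
  rw [Set.ncard_eq_two]
  refine ⟨FactorAt rote i (n + 1), FactorAt rote j (n + 1), fun hc => ?_, ?_⟩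
  · have := factorAt_eq_iff.mp hc n (by omega)
    rw [hi, hj] at this
    exact absurd this (by decide)
  · ext w
    constructor
    · rintro ⟨⟨k, rfl, hk⟩, ⟨k', hkk', hk'⟩⟩
      have hs : IsSpecialPair k k' (n + 1) := ⟨factorAt_eq_iff.mp hkk', hk, hk'⟩
      by_cases h0 : rote (k + n) = 0
      · exact Or.inl (factorAt_eq_iff.mpr (hs.agree_of_last h (h0.trans hi.symm)))
      · exact Or.inr (factorAt_eq_iff.mpr
          (hs.agree_of_last h' ((Fin.eq_one_of_ne_zero _ h0).trans hj.symm)))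
    · rintro (rfl | rfl)
      · exact ⟨⟨i, rfl, h.2.1⟩, ⟨i', factorAt_eq_iff.mpr h.1, h.2.2⟩⟩
      · exact ⟨⟨j, rfl, h'.2.1⟩, ⟨j', factorAt_eq_iff.mpr h'.1, h'.2.2⟩⟩

theorem complexity_rote_succ (n : ℕ) : complexity rote (n + 1) = 2 * (n + 1) := by
  induction n with
  | zero =>
    have h0 : factorSet rote 0 = {[]} := by
      rw [factorSet_eq_range]
      ext w
      simp [FactorAt]
    have h1 : followedBy rote 0 0 ∩ followedBy rote 0 1 = {[]} := by
      ext w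
      constructor
      · rintro ⟨⟨i, rfl, -⟩, -⟩
        rfl
      · rintro rfl
        exact ⟨⟨0, rfl, rfl⟩, ⟨1, rfl, rfl⟩⟩
    rw [complexity_succ, h1, Set.ncard_singleton]
    change (factorSet rote 0).ncard + 1 = _
    rw [h0, Set.ncard_singleton]
  | succ n ih => rw [complexity_succ, ih, ncard_right_special_rote]; ring

/-- The repetition threshold for infinite Rote sequences is `5/2`: every infinite binary
sequence with factor complexity `2n` has critical exponent at least `5/2`, and some such
sequence has critical exponent exactly `5/2`. -/
theorem stmt6 :
    (∀ x : ℕ → Fin 2, (∀ n, 1 ≤ n → complexity x n = 2 * n) →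
      (5 : ENNReal) / 2 ≤ criticalExponent x) ∧
    (∃ x : ℕ → Fin 2, (∀ n, 1 ≤ n → complexity x n = 2 * n) ∧
      criticalExponent x = 5 / 2) := by
  have lower : ∀ x : ℕ → Fin 2, (∀ n, 1 ≤ n → complexity x n = 2 * n) →
      (5 : ENNReal) / 2 ≤ criticalExponent x := fun x hx =>
    five_halves_le_criticalExponent (hx 4 (by norm_num)).le
  have hrote : ∀ n, 1 ≤ n → complexity rote n = 2 * n := fun n hn => by
    obtain ⟨m, rfl⟩ := Nat.exists_eq_add_of_le' hn
    exact complexity_rote_succ m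
  exact ⟨lower, rote, hrote,
    le_antisymm (criticalExponent_le_five_halves two_mul_le_of_agree) (lower rote hrote)⟩
end

section
/- The infinite binary word q = g(p) is uniformly recurrent with linear recurrence constant 7: for every n ≥ 1, any two consecutive occurrences of the same length-n factor of q are separated by at most 7n positions; in particular every factor of q occurs infinitely often with bounded gaps. -/
/-! ### Words over the natural numbers -/

/-- The morphism `hm`, with letters read as natural numbers. -/
def hNat : ℕ → List ℕ
  | 0 => [0, 1]
  | 1 => [2, 1]
  | _ => [0]

/-- The morphism `gm`, with letters read as natural numbers. -/
def gNat : ℕ → List ℕ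
  | 0 => [0, 1, 1]
  | 1 => [0]
  | _ => [0, 1]

/-- The morphism `σ ∘ hNat ^ k`. -/
def compPow (σ : ℕ → List ℕ) : ℕ → ℕ → List ℕ
  | 0 => σ
  | k + 1 => fun a => (hNat a).flatMap (compPow σ k)

lemma hNat_ne_nil (a : ℕ) : hNat a ≠ [] := by
  unfold hNat; split <;> simp

lemma gNat_ne_nil (a : ℕ) : gNat a ≠ [] := by
  unfold gNat; split <;> simp

lemma flatMap_ne_nil {A B : Type*} {σ : A → List B} {u : List A} (hσ : ∀ a, σ a ≠ [])
    (hu : u ≠ []) : u.flatMap σ ≠ [] := by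
  cases u with
  | nil => exact absurd rfl hu
  | cons a u => simp [hσ a]

lemma compPow_ne_nil {σ : ℕ → List ℕ} (hσ : ∀ a, σ a ≠ []) (k a : ℕ) :
    compPow σ k a ≠ [] := by
  induction k generalizing a with
  | zero => exact hσ a
  | succ k ih => exact flatMap_ne_nil ih (hNat_ne_nil a)

/-! ### Factors of infinite words -/

section Factors

variable {A B C : Type*}

@[simp] lemma FactorAt_length (x : ℕ → A) (i n : ℕ) : (FactorAt x i n).length = n := by
  simp [FactorAt]

lemma FactorAt_getElem (x : ℕ → A) (i n t : ℕ) (h : t < (FactorAt x i n).length) :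
    (FactorAt x i n)[t] = x (i + t) := by
  simp [FactorAt]

lemma FactorAt_add (x : ℕ → A) (i m n : ℕ) :
    FactorAt x i (m + n) = FactorAt x i m ++ FactorAt x (i + m) n := by
  simp [FactorAt, List.range_add, add_assoc]

lemma FactorAt_one (x : ℕ → A) (i : ℕ) : FactorAt x i 1 = [x i] := by
  simp [FactorAt]

lemma FactorAt_succ (x : ℕ → A) (i n : ℕ) :
    FactorAt x i (n + 1) = x i :: FactorAt x (i + 1) n := by
  rw [add_comm, FactorAt_add, FactorAt_one]; rfl

lemma FactorAt_take (x : ℕ → A) (i : ℕ) {m n : ℕ} (h : m ≤ n) :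
    (FactorAt x i n).take m = FactorAt x i m := by
  obtain ⟨k, rfl⟩ := Nat.exists_eq_add_of_le h
  rw [FactorAt_add, List.take_left' (by simp)]

lemma FactorAt_drop (x : ℕ → A) (i : ℕ) {m n : ℕ} (h : m ≤ n) :
    (FactorAt x i n).drop m = FactorAt x (i + m) (n - m) := by
  obtain ⟨k, rfl⟩ := Nat.exists_eq_add_of_le h
  rw [FactorAt_add, List.drop_left' (by simp), Nat.add_sub_cancel_left]

lemma FactorAt_map (v : A → B) (x : ℕ → A) (i n : ℕ) :
    (FactorAt x i n).map v = FactorAt (fun t => v (x t)) i n := by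
  simp [FactorAt]

lemma FactorAt_eq_iff (x : ℕ → A) (i j n : ℕ) :
    FactorAt x i n = FactorAt x j n ↔ ∀ t < n, x (i + t) = x (j + t) := by
  simp [FactorAt]

/-- `y` is the image of the infinite word `x` under the morphism `σ`. -/
def IsImage (σ : A → List B) (x : ℕ → A) (y : ℕ → B) : Prop :=
  ∀ m, FactorAt y 0 ((FactorAt x 0 m).flatMap σ).length = (FactorAt x 0 m).flatMap σ

/-- The position at which the image of the letter `x s` starts. -/
def blockStart (σ : A → List B) (x : ℕ → A) (s : ℕ) : ℕ :=
  ((FactorAt x 0 s).flatMap σ).length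

lemma blockStart_add (σ : A → List B) (x : ℕ → A) (s m : ℕ) :
    blockStart σ x (s + m) = blockStart σ x s + ((FactorAt x s m).flatMap σ).length := by
  simp [blockStart, FactorAt_add]

lemma blockStart_succ (σ : A → List B) (x : ℕ → A) (s : ℕ) :
    blockStart σ x (s + 1) = blockStart σ x s + (σ (x s)).length := by
  simp [blockStart_add, FactorAt_one]

lemma IsImage.factorAt {σ : A → List B} {x : ℕ → A} {y : ℕ → B} (h : IsImage σ x y)
    (s m : ℕ) :
    FactorAt y (blockStart σ x s) ((FactorAt x s m).flatMap σ).length =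
      (FactorAt x s m).flatMap σ := by
  have h2 := h (s + m)
  rw [FactorAt_add, List.flatMap_append, List.length_append, FactorAt_add, h s] at h2
  simpa [blockStart] using h2

lemma IsImage.comp {τ : A → List B} {σ : B → List C} {x : ℕ → A} {y : ℕ → B} {z : ℕ → C}
    (h₁ : IsImage τ x y) (h₂ : IsImage σ y z) :
    IsImage (fun a => (τ a).flatMap σ) x z := by
  intro m
  have h := h₂ ((FactorAt x 0 m).flatMap τ).length
  rwa [h₁ m, List.flatMap_assoc] at h

lemma isImage_applyMorph {k : ℕ} [Inhabited A] {σ : Fin k → List A} (hσ : ∀ a, σ a ≠ [])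
    (x : ℕ → Fin k) : IsImage σ x (applyMorph σ x) := by
  have key : ∀ m, (FactorAt x 0 m).flatMap σ =
      ((List.range m).map fun i => σ (x i)).flatten := by
    intro m; simp [FactorAt, List.flatMap, Function.comp_def]
  have hlen : ∀ m, m ≤ ((FactorAt x 0 m).flatMap σ).length := by
    intro m
    induction m with
    | zero => simp
    | succ m ih =>
      have := List.length_pos_iff.mpr (hσ (x m))
      rw [FactorAt_add, List.flatMap_append, List.length_append]
      simp only [FactorAt_one, zero_add, List.flatMap_singleton]
      omega
  have hpre : ∀ m n t, m ≤ n → t < ((FactorAt x 0 m).flatMap σ).length →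
      ((FactorAt x 0 n).flatMap σ).getD t default =
        ((FactorAt x 0 m).flatMap σ).getD t default := by
    intro m n t hmn ht
    obtain ⟨l, rfl⟩ := Nat.exists_eq_add_of_le hmn
    rw [FactorAt_add, List.flatMap_append, List.getD_append _ _ _ _ ht]
  intro m
  refine List.ext_getElem (by simp) fun t _ ht => ?_
  rw [FactorAt_getElem, zero_add, applyMorph, ← key,
    ← List.getD_eq_getElem _ default ht]
  rcases le_total m (t + 1) with hm | hm
  · exact hpre _ _ _ hm ht
  · exact (hpre _ _ _ hm (hlen (t + 1))).symm

lemma IsImage.map {D E : Type*} {σ : A → List B} {x : ℕ → A} {y : ℕ → B}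
    (h : IsImage σ x y) {v : A → D} {v' : B → E} {σ' : D → List E}
    (hσ : ∀ a, σ' (v a) = (σ a).map v') :
    IsImage σ' (fun t => v (x t)) (fun t => v' (y t)) := by
  intro m
  have e : (FactorAt (fun t => v (x t)) 0 m).flatMap σ' =
      ((FactorAt x 0 m).flatMap σ).map v' := by
    rw [← FactorAt_map, List.flatMap_map, List.map_flatMap]
    simp [hσ]
  rw [e, List.length_map, ← FactorAt_map, h m]

lemma exists_block {σ : A → List B} (hσ : ∀ a, σ a ≠ []) (x : ℕ → A) (i : ℕ) :
    ∃ s r, i = blockStart σ x s + r ∧ r < (σ (x s)).length := by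
  induction i with
  | zero => exact ⟨0, 0, by simp [blockStart, FactorAt], List.length_pos_iff.mpr (hσ _)⟩
  | succ i ih =>
    obtain ⟨s, r, hi, hr⟩ := ih
    by_cases h : r + 1 < (σ (x s)).length
    · exact ⟨s, r + 1, by omega, h⟩
    · refine ⟨s + 1, 0, ?_, List.length_pos_iff.mpr (hσ _)⟩
      rw [blockStart_succ]; omega

lemma IsImage.factorAt_drop {σ : A → List B} {x : ℕ → A} {y : ℕ → B} (h : IsImage σ x y)
    (s m r : ℕ) (hr : r ≤ ((FactorAt x s m).flatMap σ).length) :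
    ((FactorAt x s m).flatMap σ).drop r =
      FactorAt y (blockStart σ x s + r) (((FactorAt x s m).flatMap σ).length - r) := by
  conv_lhs => rw [← h.factorAt s m]
  exact FactorAt_drop _ _ hr

end Factors

/-! ### Recurrence inside a finite window -/

/-- The longest common prefix of two words. -/
def commonPrefix : List ℕ → List ℕ → List ℕ
  | a :: u, b :: v => bif a.beq b then a :: commonPrefix u v else []
  | _, _ => []

lemma commonPrefix_prefix (u v : List ℕ) : commonPrefix u v <+: u ∧ commonPrefix u v <+: v := by
  induction u generalizing v with
  | nil => simp [commonPrefix]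
  | cons a u ih =>
    cases v with
    | nil => simp [commonPrefix]
    | cons b v =>
      rw [commonPrefix]
      cases hab : a.beq b with
      | false => simp
      | true =>
        obtain rfl := Nat.eq_of_beq_eq_true hab
        simpa using ih v

/-- Componentwise comparison of triples. -/
def tripleLE (s t : ℕ × ℕ × ℕ) : Bool :=
  s.1.ble t.1 && (s.2.1.ble t.2.1 && s.2.2.ble t.2.2)

/-- The linear form with coefficients `c`. -/
def linForm (c t : ℕ × ℕ × ℕ) : ℕ := c.1 * t.1 + c.2.1 * t.2.1 + c.2.2 * t.2.2

lemma linForm_mono (c : ℕ × ℕ × ℕ) {s t : ℕ × ℕ × ℕ} (h : tripleLE s t = true) :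
    linForm c s ≤ linForm c t := by
  simp only [tripleLE, Bool.and_eq_true, Nat.ble_eq] at h
  obtain ⟨h₁, h₂, h₃⟩ := h
  unfold linForm
  gcongr

/-- The sum of `f` over the letters of a word. -/
def total (f : ℕ → ℕ) : List ℕ → ℕ
  | [] => 0
  | a :: u => (f a).add (total f u)

lemma total_append (f : ℕ → ℕ) (u v : List ℕ) : total f (u ++ v) = total f u + total f v := by
  induction u with
  | nil => simp [total]
  | cons a u ih => simp only [List.cons_append, total, ih, Nat.add_eq]; omega

/-- A weight in `ℕ³` for every letter, given by its coordinates. -/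
structure Weighting where
  fst : ℕ → ℕ
  snd : ℕ → ℕ
  trd : ℕ → ℕ

namespace Weighting

/-- The weight of a word. -/
def weight (f : Weighting) (u : List ℕ) : ℕ × ℕ × ℕ :=
  (total f.fst u, total f.snd u, total f.trd u)

/-- Seven times the weight of a word, plus `c` in the first coordinate. -/
def scaled (f : Weighting) (c : ℕ) (u : List ℕ) : ℕ × ℕ × ℕ :=
  (7 * total f.fst u + c, 7 * total f.snd u, 7 * total f.trd u)

/-- The difference of the weights of a word and of its suffix. -/
def diff (f : Weighting) (u v : List ℕ) : ℕ × ℕ × ℕ :=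
  (total f.fst u - total f.fst v, total f.snd u - total f.snd v, total f.trd u - total f.trd v)

lemma diff_drop (f : Weighting) (u : List ℕ) (d : ℕ) :
    f.diff u (u.drop d) = f.weight (u.take d) := by
  have h : ∀ e : ℕ → ℕ, total e u = total e (u.take d) + total e (u.drop d) := fun e => by
    rw [← total_append, List.take_append_drop]
  simp [diff, weight, h]

lemma linForm_scaled (f : Weighting) (k : ℕ × ℕ × ℕ) (c : ℕ) (u : List ℕ) :
    linForm k (f.scaled c u) = 7 * linForm k (f.weight u) + k.1 * c := by
  simp only [linForm, scaled, weight]; ring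

/-- The lengths of the images of the letters under `σ` are obtained from their weights through
the linear form with coefficients `k`. -/
def Measures (f : Weighting) (k : ℕ × ℕ × ℕ) (σ : ℕ → List ℕ) : Prop :=
  ∀ a, (σ a).length = linForm k (f.fst a, f.snd a, f.trd a)

lemma Measures.length_flatMap {f : Weighting} {k : ℕ × ℕ × ℕ} {σ : ℕ → List ℕ}
    (h : f.Measures k σ) (u : List ℕ) : (u.flatMap σ).length = linForm k (f.weight u) := by
  induction u with
  | nil => simp [linForm, weight, total]
  | cons a u ih =>
    rw [List.flatMap_cons, List.length_append, ih, h a]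
    simp only [linForm, weight, total, Nat.add_eq]; ring

end Weighting

/-- Looks for shifts `d` in a list at which prefixes of `w` reappear. A shift is used once its
weight is at most `lo` or at most the current bound `cur`, seven times the weight known to be
exceeded by the factors not treated yet; the search succeeds when this weight reaches `hi`. -/
def recurs (f : Weighting) (lo hi : ℕ × ℕ × ℕ) (c : ℕ) (w : List ℕ) :
    List ℕ → ℕ × ℕ × ℕ → Bool
  | [], _ => false
  | d :: ds, cur =>
    match commonPrefix w (w.drop d) with
    | [] => recurs f lo hi c w ds cur
    | _ :: u =>
      bif tripleLE cur (f.scaled c u) &&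
          (tripleLE (f.diff w (w.drop d)) lo || tripleLE (f.diff w (w.drop d)) cur) then
        bif tripleLE hi (f.scaled 0 u) then true
        else recurs f lo hi c w ds (f.scaled c u)
      else recurs f lo hi c w ds cur

theorem exists_shift_of_recurs {σ : ℕ → List ℕ} {x y : ℕ → ℕ} (himg : IsImage σ x y)
    (hσ : ∀ a, σ a ≠ []) {f : Weighting} {k : ℕ × ℕ × ℕ} (hf : f.Measures k σ)
    {lo hi : ℕ × ℕ × ℕ} {c n : ℕ} (hc : k.1 * c ≤ 14) (hlo : linForm k lo ≤ 7 * n)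
    (hhi : 7 * n ≤ linForm k hi) {s l o : ℕ} (ho : o < (σ (x s)).length)
    {ds : List ℕ} (hds : ∀ d ∈ ds, 0 < d) {cur : ℕ × ℕ × ℕ} (hcur : linForm k cur ≤ 7 * n)
    (h : recurs f lo hi c (FactorAt x s l) ds cur = true) :
    ∃ d, 1 ≤ d ∧ d ≤ 7 * n ∧
      FactorAt y (blockStart σ x s + o) n = FactorAt y (blockStart σ x s + o + d) n := by
  induction ds generalizing cur with
  | nil => simp [recurs] at h
  | cons d ds ih =>
    have hds' : ∀ d ∈ ds, 0 < d := fun e he => hds e (List.mem_cons_of_mem _ he)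
    rw [recurs] at h
    obtain ⟨hp₁, hp₂⟩ := commonPrefix_prefix (FactorAt x s l) ((FactorAt x s l).drop d)
    split at h
    · exact ih hds' hcur h
    · rename_i a u hu
      rw [hu] at hp₁ hp₂
      have hdl : d + (a :: u).length ≤ l := by
        have h₁ := hp₂.length_le
        simp only [List.length_drop, FactorAt_length, List.length_cons] at h₁ ⊢
        omega
      have hd0 : 0 < d := hds d List.mem_cons_self
      have e₁ : a :: u = FactorAt x s (a :: u).length := by
        have := List.prefix_iff_eq_take.mp hp₁
        rwa [FactorAt_take _ _ (by omega)] at this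
      have e₂ : a :: u = FactorAt x (s + d) (a :: u).length := by
        have := List.prefix_iff_eq_take.mp hp₂
        rwa [FactorAt_drop _ _ (by omega), FactorAt_take _ _ (by omega)] at this
      have ha : a = x s := by
        rw [List.length_cons, FactorAt_succ] at e₁
        exact (List.cons.inj e₁).1
      have i₁ := himg.factorAt s (a :: u).length
      have i₂ := himg.factorAt (s + d) (a :: u).length
      rw [← e₁] at i₁
      rw [← e₂, blockStart_add] at i₂
      replace i₂ := i₂.trans i₁.symm
      have hN : ((a :: u).flatMap σ).length = (σ (x s)).length + linForm k (f.weight u) := by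
        rw [List.flatMap_cons, List.length_append, hf.length_flatMap, ha]
      cases hb : tripleLE cur (f.scaled c u) &&
          (tripleLE (f.diff (FactorAt x s l) ((FactorAt x s l).drop d)) lo ||
            tripleLE (f.diff (FactorAt x s l) ((FactorAt x s l).drop d)) cur) with
      | false =>
        rw [hb] at h
        exact ih hds' hcur h
      | true =>
        rw [hb, cond_true] at h
        by_cases hn : o + n ≤ ((a :: u).flatMap σ).length
        · refine ⟨((FactorAt x s d).flatMap σ).length, ?_, ?_, ?_⟩
          · refine List.length_pos_iff.mpr (flatMap_ne_nil hσ ?_)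
            rw [ne_eq, ← List.length_eq_zero_iff, FactorAt_length]
            omega
          · rw [Weighting.diff_drop, FactorAt_take _ _ (by omega)] at hb
            rw [hf.length_flatMap]
            simp only [Bool.and_eq_true, Bool.or_eq_true] at hb
            rcases hb.2 with hb | hb
            · exact (linForm_mono k hb).trans hlo
            · exact (linForm_mono k hb).trans hcur
          · rw [FactorAt_eq_iff] at i₂ ⊢
            intro t ht
            rw [add_assoc, ← i₂ (o + t) (by omega)]
            congr 1
            omega
        · have hn' : linForm k (f.weight u) + 2 ≤ n := by omega
          cases hb' : tripleLE hi (f.scaled 0 u) with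
          | true =>
            have := linForm_mono k hb'
            rw [Weighting.linForm_scaled] at this
            omega
          | false =>
            rw [hb'] at h
            refine ih hds' ?_ h
            rw [Weighting.linForm_scaled]
            omega

/-- `recurs` succeeds on each of the first `r` suffixes of a word. -/
def recursTails (f : Weighting) (lo hi : ℕ × ℕ × ℕ) (c : ℕ) (ds : List ℕ) :
    ℕ → List ℕ → Bool
  | 0, _ => true
  | _, [] => true
  | r + 1, a :: w => recurs f lo hi c (a :: w) ds (0, 0, 0) && recursTails f lo hi c ds r w

lemma recurs_drop {f : Weighting} {lo hi : ℕ × ℕ × ℕ} {c : ℕ} {ds : List ℕ} {m r : ℕ}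
    {w : List ℕ} (h : recursTails f lo hi c ds m w = true) (hr : r < m) (hw : r < w.length) :
    recurs f lo hi c (w.drop r) ds (0, 0, 0) = true := by
  induction r generalizing m w with
  | zero =>
    match m, w, hr, hw, h with
    | m + 1, a :: w, _, _, h =>
      rw [recursTails, Bool.and_eq_true] at h
      exact h.1
  | succ r ih =>
    match m, w, hr, hw, h with
    | m + 1, a :: w, hr, hw, h =>
      rw [recursTails, Bool.and_eq_true] at h
      exact ih h.2 (by omega) (by simpa using hw)

/-- The factors of length five of the fixed point of `hNat`. -/
def factors5 : List (List ℕ) :=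
  [[0, 1, 0, 2, 1], [0, 1, 2, 1, 0], [0, 2, 1, 0, 1], [1, 0, 1, 0, 2], [1, 0, 1, 2, 1],
   [1, 0, 2, 1, 0], [1, 2, 1, 0, 1], [1, 2, 1, 0, 2], [2, 1, 0, 1, 0], [2, 1, 0, 1, 2],
   [2, 1, 0, 2, 1]]

/-- `recurs` succeeds from every position in the image of the first letter of a factor of
length five. -/
def recursAll (f : Weighting) (lo hi : ℕ × ℕ × ℕ) (c : ℕ) (σ : ℕ → List ℕ) (ds : List ℕ) :
    Bool :=
  factors5.all fun u => recursTails f lo hi c ds (σ (u.headD 0)).length (u.flatMap σ)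

lemma recurs_of_recursAll {σ : ℕ → List ℕ} {x y : ℕ → ℕ} (himg : IsImage σ x y)
    (hσ : ∀ a, σ a ≠ []) (hx : ∀ s, FactorAt x s 5 ∈ factors5) {f : Weighting}
    {lo hi : ℕ × ℕ × ℕ} {c : ℕ} {ds : List ℕ} (h : recursAll f lo hi c σ ds = true) (i : ℕ) :
    ∃ l, recurs f lo hi c (FactorAt y i l) ds (0, 0, 0) = true := by
  obtain ⟨s, r, rfl, hr⟩ := exists_block hσ x i
  have hu := List.all_eq_true.mp h _ (hx s)
  have hr' : r < ((FactorAt x s 5).flatMap σ).length := by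
    rw [FactorAt_succ, List.flatMap_cons, List.length_append]
    omega
  have := recurs_drop hu (r := r) (by simpa [FactorAt_succ] using hr) hr'
  rw [himg.factorAt_drop s 5 r hr'.le] at this
  exact ⟨_, this⟩

lemma factors5_closed :
    ∀ u ∈ factors5, ∀ r < (hNat (u.headD 0)).length,
      5 ≤ ((u.flatMap hNat).drop r).length ∧ ((u.flatMap hNat).drop r).take 5 ∈ factors5 := by
  decide +kernel

lemma factorAt_mem_factors5 {x : ℕ → ℕ} (hx0 : x 0 = 0) (himg : IsImage hNat x x) (s : ℕ) :
    FactorAt x s 5 ∈ factors5 := by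
  induction s using Nat.strong_induction_on with
  | _ i ih =>
    rcases Nat.eq_zero_or_pos i with rfl | hi
    · have h₁ : FactorAt x 0 2 = [0, 1] := by
        simpa [FactorAt_one, hx0, hNat] using himg 1
      have h₂ : FactorAt x 0 4 = [0, 1, 2, 1] := by
        simpa [h₁, hNat] using himg 2
      have h₃ : FactorAt x 0 3 = [0, 1, 2] := by
        rw [← FactorAt_take x 0 (show 3 ≤ 4 by norm_num), h₂]; rfl
      have h₄ : FactorAt x 0 5 = [0, 1, 2, 1, 0] := by
        simpa [h₃, hNat] using himg 3
      rw [h₄]; decide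
    · obtain ⟨s, r, hs, hr⟩ := exists_block hNat_ne_nil x i
      have hgrow : ∀ t, t + 2 ≤ blockStart hNat x (t + 1) := by
        intro t
        induction t with
        | zero => simp [blockStart, FactorAt_one, hx0, hNat]
        | succ t iht =>
          have := List.length_pos_iff.mpr (hNat_ne_nil (x (t + 1)))
          rw [blockStart_succ]; omega
      have hsi : s < i := by
        rcases s with _ | t
        · exact hi
        · have := hgrow t
          omega
      obtain ⟨h₁, h₂⟩ := factors5_closed _ (ih s hsi) r (by simpa [FactorAt_succ] using hr)
      have hr' : r ≤ ((FactorAt x s 5).flatMap hNat).length := by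
        rw [List.length_drop] at h₁; omega
      rw [himg.factorAt_drop s 5 r hr'] at h₁ h₂
      rw [FactorAt_length] at h₁
      rwa [FactorAt_take _ _ h₁, ← hs] at h₂

/-! ### The two words -/

lemma IsImage.compPow {σ : ℕ → List ℕ} {x y : ℕ → ℕ} (hx : IsImage hNat x x)
    (h : IsImage σ x y) (k : ℕ) : IsImage (compPow σ k) x y := by
  induction k with
  | zero => exact h
  | succ k ih => exact hx.comp ih

/-- Coefficients expressing the lengths of the images of the letters under `g ∘ h ^ k`. -/
def levelCoeff : ℕ → ℕ × ℕ × ℕ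
  | 0 => (1, 0, 0)
  | k + 1 =>
    ((levelCoeff k).2.2, (levelCoeff k).1 + (levelCoeff k).2.1,
      (levelCoeff k).2.1 + (levelCoeff k).2.2)

/-- The lengths of the images of the letters under `g`, under `g ∘ h`, and the differences
between those under `g ∘ h ^ 2` and those under `g ∘ h`. -/
def levelWeighting : Weighting where
  fst | 0 => 3 | 1 => 1 | _ => 2
  snd | 0 => 4 | 1 => 3 | _ => 3
  trd | 0 => 3 | 1 => 3 | _ => 1

lemma measures_levelWeighting (k : ℕ) :
    levelWeighting.Measures (levelCoeff k) (compPow gNat k) := by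
  induction k with
  | zero =>
    intro a
    match a with
    | 0 => rfl
    | 1 => rfl
    | a + 2 => rfl
  | succ k ih =>
    intro a
    rw [compPow, ih.length_flatMap]
    match a with
    | 0 => simp [hNat, Weighting.weight, total, levelWeighting, linForm, levelCoeff]; ring
    | 1 => simp [hNat, Weighting.weight, total, levelWeighting, linForm, levelCoeff]; ring
    | a + 2 => simp [hNat, Weighting.weight, total, levelWeighting, linForm, levelCoeff]; ring

/-- Every letter has weight one, in the first coordinate. -/
def unitWeighting : Weighting := ⟨fun _ => 1, fun _ => 0, fun _ => 0⟩

/-- Shifts at which long factors of the fixed point of `h` reappear. -/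
def longShifts : List ℕ := [28, 49, 65, 86, 114, 151, 200]

/-- Shifts at which short factors of `q` reappear. -/
def shortShifts : List ℕ :=
  [1, 2, 3, 4, 6, 7, 10, 13, 17, 23, 30, 40, 53, 70, 93, 123, 163, 216]

set_option maxRecDepth 100000 in
lemma recursAll_long :
    recursAll levelWeighting (294, 392, 294) (392, 686, 588) 0 (compPow hNat 6)
      longShifts = true := by
  decide +kernel

set_option maxRecDepth 100000 in
lemma recursAll_short :
    recursAll unitWeighting (7, 0, 0) (287, 0, 0) 14 (compPow gNat 6) shortShifts = true := by
  decide +kernel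

lemma exists_shift_of_short {x y : ℕ → ℕ} (hx0 : x 0 = 0) (hx : IsImage hNat x x)
    (hxy : IsImage gNat x y) {n : ℕ} (hn : 1 ≤ n) (hn' : n ≤ 41) (i : ℕ) :
    ∃ d, 1 ≤ d ∧ d ≤ 7 * n ∧ FactorAt y i n = FactorAt y (i + d) n := by
  obtain ⟨l, hl⟩ := recurs_of_recursAll (hx.compPow hxy 6) (compPow_ne_nil gNat_ne_nil 6)
    (factorAt_mem_factors5 hx0 hx) recursAll_short i
  have hid : IsImage (fun a => [a]) y y := fun m => by simp
  have hstart : blockStart (fun a => [a]) y i = i := by simp [blockStart]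
  have := exists_shift_of_recurs hid (by simp) (f := unitWeighting) (k := (1, 0, 0))
    (fun a => rfl) (n := n) (by simp) (by simp [linForm]; omega) (by simp [linForm]; omega)
    (o := 0) (by simp) (by decide) (by simp [linForm]) hl
  simpa [hstart] using this

lemma exists_shift_of_long {x y : ℕ → ℕ} (hx0 : x 0 = 0) (hx : IsImage hNat x x)
    (hxy : IsImage gNat x y) {n k : ℕ} (hlo : 14 * (compPow gNat k 0).length ≤ n)
    (hhi : n < 14 * (compPow gNat (k + 1) 0).length) (i : ℕ) :
    ∃ d, 1 ≤ d ∧ d ≤ 7 * n ∧ FactorAt y i n = FactorAt y (i + d) n := by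
  obtain ⟨s, o, rfl, ho⟩ := exists_block (compPow_ne_nil gNat_ne_nil k) x i
  obtain ⟨l, hl⟩ := recurs_of_recursAll (hx.compPow hx 6) (compPow_ne_nil hNat_ne_nil 6)
    (factorAt_mem_factors5 hx0 hx) recursAll_long s
  rw [measures_levelWeighting] at hlo hhi
  simp only [linForm, levelWeighting, levelCoeff] at hlo hhi
  exact exists_shift_of_recurs (hx.compPow hxy k) (compPow_ne_nil gNat_ne_nil k)
    (measures_levelWeighting k) (by simp) (by simp only [linForm]; omega)
    (by simp only [linForm]; omega) ho (by decide) (by simp [linForm]) hl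

lemma exists_shift {x y : ℕ → ℕ} (hx0 : x 0 = 0) (hx : IsImage hNat x x)
    (hxy : IsImage gNat x y) {n : ℕ} (hn : 1 ≤ n) (i : ℕ) :
    ∃ d, 1 ≤ d ∧ d ≤ 7 * n ∧ FactorAt y i n = FactorAt y (i + d) n := by
  rcases Nat.lt_or_ge 41 n with hn' | hn'
  · have hgrow : ∀ k, k ≤ (compPow gNat k 0).length := by
      intro k
      induction k with
      | zero => simp
      | succ k ih =>
        have := List.length_pos_iff.mpr (compPow_ne_nil gNat_ne_nil k 1)
        simp only [compPow, hNat, List.flatMap_cons, List.length_append]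
        omega
    have hex : ∃ k, n < 14 * (compPow gNat (k + 1) 0).length :=
      ⟨n, by have := hgrow (n + 1); omega⟩
    refine exists_shift_of_long hx0 hx hxy (k := Nat.find hex) ?_ (Nat.find_spec hex) i
    rcases hk : Nat.find hex with _ | k
    · simp [compPow, gNat]; omega
    · exact not_lt.mp (Nat.find_min hex (m := k) (by omega))
  · exact exists_shift_of_short hx0 hx hxy hn hn' i

lemma exists_shift_applyMorph {p : ℕ → Fin 3} (hp0 : p 0 = 0) (hpfix : applyMorph hm p = p)
    {n : ℕ} (hn : 1 ≤ n) (i : ℕ) :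
    ∃ d, 1 ≤ d ∧ d ≤ 7 * n ∧
      FactorAt (applyMorph gm p) i n = FactorAt (applyMorph gm p) (i + d) n := by
  have hp : IsImage hm p p := by
    have := isImage_applyMorph (σ := hm) (by decide) p
    rwa [hpfix] at this
  have hx : IsImage hNat (fun t => (p t).val) (fun t => (p t).val) :=
    hp.map (by decide)
  have hxy : IsImage gNat (fun t => (p t).val) (fun t => (applyMorph gm p t).val) :=
    (isImage_applyMorph (by decide) p).map (by decide)
  obtain ⟨d, hd, hd', h⟩ := exists_shift (by simp [hp0]) hx hxy hn i
  refine ⟨d, hd, hd', ?_⟩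
  rw [FactorAt_eq_iff] at h ⊢
  exact fun t ht => Fin.val_injective (h t ht)

/-- The word `q = g(p)` is uniformly recurrent with linear recurrence constant `7`:
any two consecutive occurrences of the same length-`n` factor (`n ≥ 1`) are separated by
at most `7n` positions; in particular every factor of `q` occurs infinitely often. -/
theorem stmt9 (p : ℕ → Fin 3) (hp0 : p 0 = 0) (hpfix : applyMorph hm p = p) :
    (∀ n, 1 ≤ n → ∀ i j : ℕ, i < j →
      FactorAt (applyMorph gm p) i n = FactorAt (applyMorph gm p) j n →
      (∀ t, i < t → t < j → FactorAt (applyMorph gm p) t n ≠ FactorAt (applyMorph gm p) i n) →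
      j - i ≤ 7 * n) ∧
    (∀ w : List (Fin 2), IsFactor (applyMorph gm p) w →
      ∀ N : ℕ, ∃ i, N ≤ i ∧ FactorAt (applyMorph gm p) i w.length = w) := by
  refine ⟨fun n hn i j _ _ hmin => ?_, ?_⟩
  · obtain ⟨d, hd, hd', h⟩ := exists_shift_applyMorph hp0 hpfix hn i
    by_contra hlt
    exact hmin (i + d) (by omega) (by omega) h.symm
  · rintro w ⟨i, hw⟩ N
    rcases Nat.eq_zero_or_pos w.length with h0 | hpos
    · exact ⟨N, le_rfl, by rw [List.length_eq_zero_iff.mp h0]; rfl⟩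
    · induction N with
      | zero => exact ⟨i, Nat.zero_le i, hw.symm⟩
      | succ N ih =>
        obtain ⟨j, hj, hjw⟩ := ih
        obtain ⟨d, hd, _, h⟩ := exists_shift_applyMorph hp0 hpfix hpos j
        exact ⟨j + d, by omega, h.symm.trans hjw⟩
end
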